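/- arXiv:2510.04875 — 3 statements merged into one kernel-verified Lean document; each statement's English description precedes it below -/
import Mathlib

section
/- Fix (z,w) ∈ Λ with representative sequence (z_i,w_i)_{i∈ℕ} ∈ Σ̄. Suppose the limits λ := lim_{n→∞} λ(n)/n and ξ := lim_{n→∞} ξ(n)/n exist and ξ > λ. Suppose further that for each a ∈ {0,…,b−1} the digit frequency p_a(z,w) := lim_{n→∞} #{1 ≤ i ≤ n : w_i = a}/n exists, with p_0(z,w) < 1 and p_{b−1}(z,w) < 1. Then dim_H Λ_{λ,ξ}(z,w) = min{ γ/(1+λ), (γ + (ξ−λ)·γ(z,w)₂)/(1+ξ) }, where γ = log #J / log b = dim_H Λ and γ(z,w)₂ = (Σ_{a=0}^{b−1} p_a(z,w) log #J₂(a)) / log b = dim_H(Λ ∩ {(x,y) ∈ [0,1]² : y = w}). -/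
open Set Filter Topology MeasureTheory
open scoped ENNReal NNReal Topology

noncomputable section

namespace ShrinkingRect

/-- The real number with 1-indexed base-`b` digit sequence `u` (digit `i` is `u i` for `i ≥ 1`). -/
def val (b : ℕ) (u : ℕ → ℕ) : ℝ := ∑' i : ℕ, (u (i + 1) : ℝ) / (b : ℝ) ^ (i + 1)

/-- The self-similar carpet `Λ` with digit set `J ⊆ {0,…,b−1}²`. -/
def carpet (b : ℕ) (J : Finset (ℕ × ℕ)) : Set (ℝ × ℝ) :=
  {p | ∃ d : ℕ → ℕ × ℕ, (∀ i, 1 ≤ i → d i ∈ J) ∧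
    p = (val b (fun i => (d i).1), val b (fun i => (d i).2))}

/-- `J₂(a)`: the digits of `J` lying in row `a`. -/
def J2 (J : Finset (ℕ × ℕ)) (a : ℕ) : Finset (ℕ × ℕ) := J.filter fun p => p.2 = a

/-- The contraction `f_{u,v}(x,y) = ((x+u)/b, (y+v)/b)`. -/
def fmap (b : ℕ) (uv : ℕ × ℕ) (p : ℝ × ℝ) : ℝ × ℝ :=
  ((p.1 + (uv.1 : ℝ)) / b, (p.2 + (uv.2 : ℝ)) / b)

/-- `f_t = f_{u₁,v₁} ∘ ⋯ ∘ f_{uₙ,vₙ}` for a finite word `t = ((u₁,v₁),…,(uₙ,vₙ))`. -/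
def fword (b : ℕ) (t : List (ℕ × ℕ)) (p : ℝ × ℝ) : ℝ × ℝ :=
  t.foldr (fmap b) p

/-- The limsup set `W_{λ,ξ}(z,w)`. -/
def Wset (b : ℕ) (J : Finset (ℕ × ℕ)) (lam xi : ℕ → ℕ) (z w : ℝ) : Set (ℝ × ℝ) :=
  {p | p ∈ carpet b J ∧
    {t : List (ℕ × ℕ) | t ≠ [] ∧ (∀ e ∈ t, e ∈ J) ∧
      |p.1 - (fword b t (z, w)).1| ≤ (b : ℝ) ^ (-(lam t.length : ℤ) - (t.length : ℤ)) ∧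
      |p.2 - (fword b t (z, w)).2| ≤ (b : ℝ) ^ (-(xi t.length : ℤ) - (t.length : ℤ))}.Infinite}

/-- The closeness condition (in one coordinate) defining `M_n(z,w)`:
`xd` is the digit string of the point, `zd` that of the centre, `L` is `λ(n)` or `ξ(n)`. -/
def closeCond (b L n : ℕ) (zd xd : ℕ → ℕ) : Prop :=
  (∀ i, 1 ≤ i → i < L → xd (i + n) = zd i) ∨
  (∃ j, 1 ≤ j ∧ j < L ∧ (∀ i, 1 ≤ i → i ≤ j - 1 → xd (i + n) = zd i) ∧
    (((xd (j + n) : ℤ) - (zd j : ℤ) = -1 ∧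
        ∀ i, j + 1 ≤ i → i < L → (xd (i + n) : ℤ) - (zd i : ℤ) = (b : ℤ) - 1) ∨
     ((xd (j + n) : ℤ) - (zd j : ℤ) = 1 ∧
        ∀ i, j + 1 ≤ i → i < L → (zd i : ℤ) - (xd (i + n) : ℤ) = (b : ℤ) - 1)))

/-- A choice of representative digit sequences for the points of the carpet: each point of `Λ`
gets a digit sequence in `J` representing it, whose partial products of row cardinalities
`∏ #J₂(y_i)` are eventually maximal among all representations of that point. -/
structure RepMap (b : ℕ) (J : Finset (ℕ × ℕ)) where
  rep : ℝ × ℝ → ℕ → ℕ × ℕ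
  mem_J : ∀ p ∈ carpet b J, ∀ i, 1 ≤ i → rep p i ∈ J
  eq_val : ∀ p ∈ carpet b J,
    p = (val b (fun i => (rep p i).1), val b (fun i => (rep p i).2))
  maximal : ∀ p ∈ carpet b J, ∀ d : ℕ → ℕ × ℕ, (∀ i, 1 ≤ i → d i ∈ J) →
    p = (val b (fun i => (d i).1), val b (fun i => (d i).2)) →
    ∃ N₀ : ℕ, ∀ N, N₀ ≤ N →
      ∏ i ∈ Finset.Icc 1 N, (J2 J (d i).2).card ≤
        ∏ i ∈ Finset.Icc 1 N, (J2 J (rep p i).2).card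

/-- The expanding map `T(x,y) = (bx − x₁, by − y₁)`, where `(x_i,y_i)` is the representative
digit sequence of `(x,y)`. -/
def Tmap {b : ℕ} {J : Finset (ℕ × ℕ)} (R : RepMap b J) (p : ℝ × ℝ) : ℝ × ℝ :=
  ((b : ℝ) * p.1 - ((R.rep p 1).1 : ℝ), (b : ℝ) * p.2 - ((R.rep p 1).2 : ℝ))

/-- The shrinking target set `Λ_{λ,ξ}(z,w)`. -/
def targetSet {b : ℕ} {J : Finset (ℕ × ℕ)} (R : RepMap b J) (lam xi : ℕ → ℕ)
    (z w : ℝ) : Set (ℝ × ℝ) :=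
  {p | p ∈ carpet b J ∧ ∃ᶠ n in atTop,
    ((Tmap R)^[n] p).1 ∈ Icc (z - (b : ℝ) ^ (-(lam n : ℤ))) (z + (b : ℝ) ^ (-(lam n : ℤ))) ∧
    ((Tmap R)^[n] p).2 ∈ Icc (w - (b : ℝ) ^ (-(xi n : ℤ))) (w + (b : ℝ) ^ (-(xi n : ℤ)))}

/-- The set `M_n(z,w)` (as a set of points of `Λ`, via representative sequences). -/
def Mset {b : ℕ} {J : Finset (ℕ × ℕ)} (R : RepMap b J) (lam xi : ℕ → ℕ)
    (zw : ℝ × ℝ) (n : ℕ) : Set (ℝ × ℝ) :=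
  {p | p ∈ carpet b J ∧
    closeCond b (lam n) n (fun i => (R.rep zw i).1) (fun i => (R.rep p i).1) ∧
    closeCond b (xi n) n (fun i => (R.rep zw i).2) (fun i => (R.rep p i).2)}

/-- `p_{n,j}(a,y) = #{λ(n) ≤ i ≤ j : y_{i+n} = a}`. -/
def pcount {b : ℕ} {J : Finset (ℕ × ℕ)} (R : RepMap b J) (lam : ℕ → ℕ)
    (p : ℝ × ℝ) (a n j : ℕ) : ℕ :=
  ((Finset.Icc (lam n) j).filter fun i => (R.rep p (i + n)).2 = a).card

/-- `A_{n,j}(z,w) = max_{(x,y) ∈ M_n(z,w)} Σ_a p_{n,j}(a,y) log #J₂(a)`. -/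
def Aval {b : ℕ} {J : Finset (ℕ × ℕ)} (R : RepMap b J) (lam xi : ℕ → ℕ)
    (zw : ℝ × ℝ) (n j : ℕ) : ℝ :=
  sSup ((fun p => ∑ a ∈ Finset.range b,
    (pcount R lam p a n j : ℝ) * Real.log ((J2 J a).card)) '' Mset R lam xi zw n)

/-- `s_n = min{ (n log #J + A_{n,j}(z,w)) / ((n+j) log b) : λ(n) ≤ j ≤ ξ(n) }`. -/
def sval {b : ℕ} {J : Finset (ℕ × ℕ)} (R : RepMap b J) (lam xi : ℕ → ℕ)
    (zw : ℝ × ℝ) (n : ℕ) : ℝ :=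
  sInf ((fun j : ℕ => ((n : ℝ) * Real.log J.card + Aval R lam xi zw n j) /
    (((n : ℝ) + (j : ℝ)) * Real.log b)) '' Set.Icc (lam n) (xi n))

/-- `#{1 ≤ i ≤ n : u i = a}`. -/
def freqCount (u : ℕ → ℕ) (a n : ℕ) : ℕ := ((Finset.Icc 1 n).filter fun i => u i = a).card

/-- The second-coordinate digit string of the representative sequence of a point. -/
def wdig {b : ℕ} {J : Finset (ℕ × ℕ)} (R : RepMap b J) (zw : ℝ × ℝ) (i : ℕ) : ℕ :=
  (R.rep zw i).2

section Auxiliary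

/-! ### Digit expansions and their integer prefixes -/

/-- The integer whose base-`b` digits are `u 1, …, u m`. -/
def prefixVal (b : ℕ) (u : ℕ → ℕ) : ℕ → ℕ
  | 0 => 0
  | m + 1 => b * prefixVal b u m + u (m + 1)

variable {b : ℕ} {u v : ℕ → ℕ}

theorem val_congr (h : ∀ i, 1 ≤ i → u i = v i) : val b u = val b v := by
  unfold val
  exact tsum_congr fun i => by rw [h (i + 1) (by lia)]

theorem prefixVal_congr {m : ℕ} (h : ∀ i, 1 ≤ i → i ≤ m → u i = v i) :
    prefixVal b u m = prefixVal b v m := by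
  induction m with
  | zero => rfl
  | succ m ih =>
    simp only [prefixVal]
    rw [ih fun i h1 h2 => h i h1 (by lia), h (m + 1) (by lia) le_rfl]

theorem prefixVal_lt (hu : ∀ i, 1 ≤ i → u i < b) (m : ℕ) : prefixVal b u m < b ^ m := by
  induction m with
  | zero => simp [prefixVal]
  | succ m ih =>
    have h1 := hu (m + 1) (by lia)
    simp only [prefixVal, pow_succ]
    nlinarith

theorem prefixVal_add (u : ℕ → ℕ) (j k : ℕ) :
    prefixVal b u (j + k) = b ^ k * prefixVal b u j + prefixVal b (fun i => u (i + j)) k := by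
  induction k with
  | zero => simp [prefixVal]
  | succ k ih =>
    rw [← add_assoc]
    simp only [prefixVal]
    rw [ih, show j + k + 1 = k + 1 + j by ring]
    ring

theorem eq_of_prefixVal_eq (hu : ∀ i, 1 ≤ i → u i < b) (hv : ∀ i, 1 ≤ i → v i < b) {m : ℕ}
    (h : prefixVal b u m = prefixVal b v m) : ∀ i, 1 ≤ i → i ≤ m → u i = v i := by
  induction m with
  | zero => intro i h1 h2; lia
  | succ m ih =>
    have h1 := hu (m + 1) (by lia)
    have h2 := hv (m + 1) (by lia)
    simp only [prefixVal] at h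
    have hmod : u (m + 1) = v (m + 1) := by
      have := congrArg (· % b) h
      simpa [Nat.mul_add_mod, Nat.mod_eq_of_lt h1, Nat.mod_eq_of_lt h2] using this
    have hdiv : prefixVal b u m = prefixVal b v m := by
      rw [hmod] at h
      exact Nat.eq_of_mul_eq_mul_left (by lia : 0 < b) (by lia)
    intro i hi1 hi2
    rcases Nat.lt_or_ge i (m + 1) with hi | hi
    · exact ih hdiv i hi1 (by lia)
    · rw [show i = m + 1 by lia, hmod]

theorem prefixVal_pos (hb : 2 ≤ b) {k : ℕ} (h : ∃ i, 1 ≤ i ∧ i ≤ k ∧ u i ≠ 0) :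
    1 ≤ prefixVal b u k := by
  induction k with
  | zero => obtain ⟨i, h1, h2, -⟩ := h; lia
  | succ k ih =>
    obtain ⟨i, h1, h2, h3⟩ := h
    simp only [prefixVal]
    rcases Nat.lt_or_ge i (k + 1) with hi | hi
    · have := ih ⟨i, h1, by lia, h3⟩
      nlinarith
    · rw [show i = k + 1 by lia] at h3
      have := Nat.pos_of_ne_zero h3
      lia

theorem prefixVal_add_two_le (hb : 2 ≤ b) (hu : ∀ i, 1 ≤ i → u i < b) {k : ℕ}
    (h : ∃ i, 1 ≤ i ∧ i ≤ k ∧ u i ≠ b - 1) : prefixVal b u k + 2 ≤ b ^ k := by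
  induction k with
  | zero => obtain ⟨i, h1, h2, -⟩ := h; lia
  | succ k ih =>
    obtain ⟨i, h1, h2, h3⟩ := h
    have hk := hu (k + 1) (by lia)
    simp only [prefixVal, pow_succ]
    rcases Nat.lt_or_ge i (k + 1) with hi | hi
    · have := ih ⟨i, h1, by lia, h3⟩
      nlinarith
    · rw [show i = k + 1 by lia] at h3
      have := prefixVal_lt hu k
      have : u (k + 1) + 2 ≤ b := by lia
      nlinarith

theorem summable_digits (hb : 2 ≤ b) (hu : ∀ i, 1 ≤ i → u i < b) :
    Summable fun i : ℕ => (u (i + 1) : ℝ) / (b : ℝ) ^ (i + 1) := by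
  have hb' : (2 : ℝ) ≤ b := by exact_mod_cast hb
  refine Summable.of_nonneg_of_le (fun i => by positivity) (fun i => ?_)
    (summable_geometric_of_lt_one (r := (b : ℝ)⁻¹) (by positivity)
      (inv_lt_one_of_one_lt₀ (by linarith)))
  have h1 : (u (i + 1) : ℝ) ≤ b := by exact_mod_cast (hu (i + 1) (by lia)).le
  rw [pow_succ, inv_pow, div_le_iff₀ (by positivity)]
  rw [inv_mul_cancel_left₀ (by positivity)]
  exact h1

theorem val_eq_shift (hb : 2 ≤ b) (hu : ∀ i, 1 ≤ i → u i < b) :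
    val b u = (u 1 + val b (fun i => u (i + 1))) / b := by
  have hb' : (2 : ℝ) ≤ b := by exact_mod_cast hb
  unfold val
  rw [(summable_digits hb hu).tsum_eq_zero_add, add_div]
  congr 1
  · simp
  · rw [← tsum_div_const]
    refine tsum_congr fun i => ?_
    rw [div_div, ← pow_succ]

theorem val_nonneg : 0 ≤ val b u := tsum_nonneg fun i => by positivity

theorem val_le_one (hb : 2 ≤ b) (hu : ∀ i, 1 ≤ i → u i < b) : val b u ≤ 1 := by
  have hb' : (2 : ℝ) ≤ b := by exact_mod_cast hb
  have hg : HasSum (fun i : ℕ => ((b : ℝ) - 1) / b * (b : ℝ)⁻¹ ^ i) 1 := by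
    have := (hasSum_geometric_of_lt_one (r := (b : ℝ)⁻¹) (by positivity)
      (inv_lt_one_of_one_lt₀ (by linarith))).mul_left (((b : ℝ) - 1) / b)
    have h1 : (b : ℝ) - 1 ≠ 0 := by linarith
    have h2 : (b : ℝ) ≠ 0 := by linarith
    have h3 : 1 - (b : ℝ)⁻¹ = (b - 1) / b := by field_simp
    rwa [h3, mul_inv_cancel₀ (div_ne_zero h1 h2)] at this
  unfold val
  refine hasSum_le (fun i => ?_) (summable_digits hb hu).hasSum hg
  have h1 : (u (i + 1) : ℝ) ≤ b - 1 := by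
    have : u (i + 1) + 1 ≤ b := hu (i + 1) (by lia)
    have : ((u (i + 1) + 1 : ℕ) : ℝ) ≤ b := by exact_mod_cast this
    push_cast at this
    linarith
  have h3 : ((b : ℝ) - 1) / b * (b : ℝ)⁻¹ ^ i = (b - 1) / b ^ (i + 1) := by
    rw [inv_pow, pow_succ]
    field_simp
  rw [h3]
  gcongr

theorem val_eq_prefixVal_add (hb : 2 ≤ b) (hu : ∀ i, 1 ≤ i → u i < b) (m : ℕ) :
    val b u = (prefixVal b u m + val b (fun i => u (i + m))) / (b : ℝ) ^ m := by
  have hb' : (2 : ℝ) ≤ b := by exact_mod_cast hb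
  induction m with
  | zero => simp [prefixVal]
  | succ m ih =>
    rw [ih, val_eq_shift hb (u := fun i => u (i + m)) fun i _ => hu _ (by lia)]
    have : (fun i => u (i + (m + 1))) = fun i => u (i + 1 + m) := by
      funext i; rw [show i + (m + 1) = i + 1 + m by ring]
    rw [this]
    simp only [prefixVal]
    rw [show 1 + m = m + 1 by ring]
    push_cast
    have h2 : (b : ℝ) ≠ 0 := by linarith
    field_simp
    ring

theorem prefixVal_le_mul_val (hb : 2 ≤ b) (hu : ∀ i, 1 ≤ i → u i < b) (m : ℕ) :
    (prefixVal b u m : ℝ) ≤ (b : ℝ) ^ m * val b u := by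
  have hb' : (2 : ℝ) ≤ b := by exact_mod_cast hb
  rw [val_eq_prefixVal_add hb hu m, mul_div_cancel₀ _ (by positivity)]
  linarith [val_nonneg (b := b) (u := fun i => u (i + m))]

theorem mul_val_le_prefixVal (hb : 2 ≤ b) (hu : ∀ i, 1 ≤ i → u i < b) (m : ℕ) :
    (b : ℝ) ^ m * val b u ≤ prefixVal b u m + 1 := by
  have hb' : (2 : ℝ) ≤ b := by exact_mod_cast hb
  rw [val_eq_prefixVal_add hb hu m, mul_div_cancel₀ _ (by positivity)]
  linarith [val_le_one hb (u := fun i => u (i + m)) fun i _ => hu _ (by lia)]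

theorem abs_val_sub_val_le (hb : 2 ≤ b) (hu : ∀ i, 1 ≤ i → u i < b) (hv : ∀ i, 1 ≤ i → v i < b)
    {m : ℕ} (h : ∀ i, 1 ≤ i → i ≤ m → u i = v i) :
    |val b u - val b v| ≤ ((b : ℝ) ^ m)⁻¹ := by
  have hb' : (2 : ℝ) ≤ b := by exact_mod_cast hb
  have h1 := prefixVal_le_mul_val hb hu m
  have h2 := mul_val_le_prefixVal hb hu m
  have h3 := prefixVal_le_mul_val hb hv m
  have h4 := mul_val_le_prefixVal hb hv m
  rw [prefixVal_congr h] at h1 h2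
  have hpos : (0 : ℝ) < (b : ℝ) ^ m := by positivity
  rw [← one_div, le_div_iff₀ hpos, ← abs_of_pos hpos, ← abs_mul, abs_le]
  constructor <;> nlinarith

theorem abs_prefixVal_sub_le (hb : 2 ≤ b) (hu : ∀ i, 1 ≤ i → u i < b)
    (hv : ∀ i, 1 ≤ i → v i < b) {m : ℕ} {c : ℕ} (h : |val b u - val b v| < c * ((b : ℝ) ^ m)⁻¹) :
    |(prefixVal b u m : ℤ) - prefixVal b v m| ≤ c := by
  have hb' : (2 : ℝ) ≤ b := by exact_mod_cast hb
  have h1 := prefixVal_le_mul_val hb hu m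
  have h2 := mul_val_le_prefixVal hb hu m
  have h3 := prefixVal_le_mul_val hb hv m
  have h4 := mul_val_le_prefixVal hb hv m
  have hpos : (0 : ℝ) < (b : ℝ) ^ m := by positivity
  rw [← div_eq_mul_inv, lt_div_iff₀ hpos, ← abs_of_pos hpos, ← abs_mul, abs_lt] at h
  have h5 : ((prefixVal b u m : ℤ) : ℝ) < (prefixVal b v m : ℤ) + c + 1 := by
    push_cast; nlinarith
  have h6 : ((prefixVal b v m : ℤ) : ℝ) < (prefixVal b u m : ℤ) + c + 1 := by
    push_cast; nlinarith
  have h5' : (prefixVal b u m : ℤ) < (prefixVal b v m : ℤ) + c + 1 := by exact_mod_cast h5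
  have h6' : (prefixVal b v m : ℤ) < (prefixVal b u m : ℤ) + c + 1 := by exact_mod_cast h6
  rw [abs_le]
  constructor <;> linarith

/-- Two expansions of nearby reals share their first `j` digits as soon as one of them has a
nonzero digit and a digit other than `b - 1` between the places `j` and `q`. -/
theorem digits_eq_of_abs_val_sub_lt (hb : 2 ≤ b) (hu : ∀ i, 1 ≤ i → u i < b)
    (hv : ∀ i, 1 ≤ i → v i < b) {j q : ℕ} (hjq : j ≤ q)
    (h0 : ∃ i, j < i ∧ i ≤ q ∧ u i ≠ 0) (h1 : ∃ i, j < i ∧ i ≤ q ∧ u i ≠ b - 1)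
    (h : |val b u - val b v| < ((b : ℝ) ^ q)⁻¹) : ∀ i, 1 ≤ i → i ≤ j → u i = v i := by
  obtain ⟨k, rfl⟩ := Nat.exists_eq_add_of_le hjq
  have h2 := abs_prefixVal_sub_le hb hu hv (m := j + k) (c := 1) (by simpa using h)
  have h3 : 1 ≤ prefixVal b (fun i => u (i + j)) k := by
    obtain ⟨i, hi1, hi2, hi3⟩ := h0
    exact prefixVal_pos hb ⟨i - j, by lia, by lia, by simpa [Nat.sub_add_cancel hi1.le] using hi3⟩
  have h4 : prefixVal b (fun i => u (i + j)) k + 2 ≤ b ^ k := by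
    obtain ⟨i, hi1, hi2, hi3⟩ := h1
    exact prefixVal_add_two_le hb (fun i _ => hu _ (by lia))
      ⟨i - j, by lia, by lia, by simpa [Nat.sub_add_cancel hi1.le] using hi3⟩
  have h5 := prefixVal_lt (b := b) (u := fun i => v (i + j)) (fun i _ => hv _ (by lia)) k
  rw [prefixVal_add, prefixVal_add, abs_le] at h2
  refine eq_of_prefixVal_eq hu hv ?_
  set r := prefixVal b (fun i => u (i + j)) k
  set s := prefixVal b (fun i => v (i + j)) k
  set B := b ^ k
  rcases lt_trichotomy (prefixVal b u j) (prefixVal b v j) with hlt | heq | hlt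
  · have : B * (prefixVal b u j + 1) ≤ B * prefixVal b v j := Nat.mul_le_mul_left _ hlt
    push_cast at h2
    zify at this h3 h4 h5
    linarith [h2.1]
  · exact heq
  · have : B * (prefixVal b v j + 1) ≤ B * prefixVal b u j := Nat.mul_le_mul_left _ hlt
    push_cast at h2
    zify at this h3 h4 h5
    linarith [h2.2]

theorem digits_eq_of_val_eq (hb : 2 ≤ b) (hu : ∀ i, 1 ≤ i → u i < b)
    (hv : ∀ i, 1 ≤ i → v i < b) (h0 : ∀ N, ∃ i, N < i ∧ u i ≠ 0)
    (h1 : ∀ N, ∃ i, N < i ∧ u i ≠ b - 1) (h : val b u = val b v) :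
    ∀ i, 1 ≤ i → u i = v i := by
  intro i hi
  obtain ⟨q0, hq0, hq0'⟩ := h0 i
  obtain ⟨q1, hq1, hq1'⟩ := h1 i
  have hb' : (2 : ℝ) ≤ b := by exact_mod_cast hb
  exact digits_eq_of_abs_val_sub_lt hb hu hv (j := i) (q := max q0 q1) (by lia)
    ⟨q0, hq0, by lia, hq0'⟩ ⟨q1, hq1, by lia, hq1'⟩
    (by rw [h, sub_self, abs_zero]; positivity) i hi le_rfl

/-! ### Points of the carpet and the expanding map -/

/-- The point of the plane with digit sequence `d`. -/
def point (b : ℕ) (d : ℕ → ℕ × ℕ) : ℝ × ℝ :=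
  (val b (fun i => (d i).1), val b (fun i => (d i).2))

variable {J : Finset (ℕ × ℕ)} {d e : ℕ → ℕ × ℕ}

theorem point_congr (h : ∀ i, 1 ≤ i → d i = e i) : point b d = point b e := by
  unfold point
  rw [val_congr fun i hi => congrArg Prod.fst (h i hi),
    val_congr fun i hi => congrArg Prod.snd (h i hi)]

theorem fst_lt_of_mem (hJ : J ⊆ Finset.range b ×ˢ Finset.range b) {a : ℕ × ℕ} (ha : a ∈ J) :
    a.1 < b :=
  Finset.mem_range.1 (Finset.mem_product.1 (hJ ha)).1

theorem snd_lt_of_mem (hJ : J ⊆ Finset.range b ×ˢ Finset.range b) {a : ℕ × ℕ} (ha : a ∈ J) :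
    a.2 < b :=
  Finset.mem_range.1 (Finset.mem_product.1 (hJ ha)).2

theorem point_mem_carpet (hd : ∀ i, 1 ≤ i → d i ∈ J) : point b d ∈ carpet b J :=
  ⟨d, hd, rfl⟩

theorem point_rep (R : RepMap b J) {p : ℝ × ℝ} (hp : p ∈ carpet b J) : point b (R.rep p) = p :=
  (R.eq_val p hp).symm

theorem edist_point_le (hb : 2 ≤ b) (hJ : J ⊆ Finset.range b ×ˢ Finset.range b)
    (hd : ∀ i, 1 ≤ i → d i ∈ J) (he : ∀ i, 1 ≤ i → e i ∈ J) {m : ℕ}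
    (h : ∀ i, 1 ≤ i → i ≤ m → d i = e i) :
    edist (point b d) (point b e) ≤ ENNReal.ofReal ((b : ℝ) ^ m)⁻¹ := by
  rw [edist_dist]
  apply ENNReal.ofReal_le_ofReal
  rw [Prod.dist_eq, max_le_iff, Real.dist_eq, Real.dist_eq]
  exact ⟨abs_val_sub_val_le hb (fun i hi => fst_lt_of_mem hJ (hd i hi))
      (fun i hi => fst_lt_of_mem hJ (he i hi)) fun i h1 h2 => by rw [h i h1 h2],
    abs_val_sub_val_le hb (fun i hi => snd_lt_of_mem hJ (hd i hi))
      (fun i hi => snd_lt_of_mem hJ (he i hi)) fun i h1 h2 => by rw [h i h1 h2]⟩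

theorem point_eq_shift (hb : 2 ≤ b) (hJ : J ⊆ Finset.range b ×ˢ Finset.range b)
    (hd : ∀ i, 1 ≤ i → d i ∈ J) :
    point b d = fmap b (d 1) (point b fun i => d (i + 1)) := by
  unfold point fmap
  rw [val_eq_shift hb fun i hi => fst_lt_of_mem hJ (hd i hi),
    val_eq_shift hb fun i hi => snd_lt_of_mem hJ (hd i hi)]
  simp only [add_comm]

theorem Tmap_eq_point (hb : 2 ≤ b) (hJ : J ⊆ Finset.range b ×ˢ Finset.range b) (R : RepMap b J)
    {p : ℝ × ℝ} (hp : p ∈ carpet b J) : Tmap R p = point b fun i => R.rep p (i + 1) := by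
  have hb' : (2 : ℝ) ≤ b := by exact_mod_cast hb
  have h0 : (b : ℝ) ≠ 0 := by linarith
  have h := point_eq_shift hb hJ (R.mem_J p hp)
  rw [point_rep R hp] at h
  have h1 := congrArg Prod.fst h
  have h2 := congrArg Prod.snd h
  simp only [fmap] at h1 h2
  unfold Tmap
  ext
  · rw [h1]; field_simp; ring
  · rw [h2]; field_simp; ring

theorem exists_digits_of_Tmap_iterate (hb : 2 ≤ b) (hJ : J ⊆ Finset.range b ×ˢ Finset.range b)
    (R : RepMap b J) (n : ℕ) {p : ℝ × ℝ} (hp : p ∈ carpet b J) :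
    ∃ d : ℕ → ℕ × ℕ, (∀ i, 1 ≤ i → d i ∈ J) ∧ p = point b d ∧
      (Tmap R)^[n] p = point b fun i => d (i + n) := by
  induction n generalizing p with
  | zero => exact ⟨R.rep p, R.mem_J p hp, (point_rep R hp).symm, (point_rep R hp).symm⟩
  | succ n ih =>
    have hT := Tmap_eq_point hb hJ R hp
    have hTmem : Tmap R p ∈ carpet b J :=
      hT ▸ point_mem_carpet fun i _ => R.mem_J p hp _ (by lia)
    obtain ⟨d, hd, hpd, hdn⟩ := ih hTmem
    have hmem : ∀ i, 1 ≤ i → (if i = 1 then R.rep p 1 else d (i - 1)) ∈ J := by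
      intro i hi
      split_ifs with h
      · exact R.mem_J p hp 1 le_rfl
      · exact hd _ (by lia)
    refine ⟨fun i => if i = 1 then R.rep p 1 else d (i - 1), hmem, ?_, ?_⟩
    · refine (point_rep R hp).symm.trans ?_
      rw [point_eq_shift hb hJ hmem, point_eq_shift hb hJ (R.mem_J p hp), ← hT, hpd, if_pos rfl]
      congr 1
    · rw [Function.iterate_succ_apply, hdn]
      refine point_congr fun i hi => ?_
      simp only [if_neg (show i + (n + 1) ≠ 1 by lia)]
      congr 1

/-- Digit sequences which are the only expansion over `J` of the point they represent. -/
structure IsGeneric (b : ℕ) (J : Finset (ℕ × ℕ)) (d : ℕ → ℕ × ℕ) : Prop where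
  mem : ∀ i, 1 ≤ i → d i ∈ J
  fst : (∀ a ∈ J, ∀ a' ∈ J, a.1 = a'.1) ∨
    ((∀ N, ∃ i, N < i ∧ (d i).1 ≠ 0) ∧ ∀ N, ∃ i, N < i ∧ (d i).1 ≠ b - 1)
  snd_ne_zero : ∀ N, ∃ i, N < i ∧ (d i).2 ≠ 0
  snd_ne_pred : ∀ N, ∃ i, N < i ∧ (d i).2 ≠ b - 1

theorem IsGeneric.eq_of_point_eq (hb : 2 ≤ b) (hJ : J ⊆ Finset.range b ×ˢ Finset.range b)
    (hd : IsGeneric b J d) (he : ∀ i, 1 ≤ i → e i ∈ J) (h : point b d = point b e) :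
    ∀ i, 1 ≤ i → d i = e i := by
  intro i hi
  refine Prod.ext ?_ ?_
  · rcases hd.fst with h1 | ⟨h0, h1⟩
    · exact h1 _ (hd.mem i hi) _ (he i hi)
    · exact digits_eq_of_val_eq hb (fun i hi => fst_lt_of_mem hJ (hd.mem i hi))
        (fun i hi => fst_lt_of_mem hJ (he i hi)) h0 h1 (congrArg Prod.fst h) i hi
  · exact digits_eq_of_val_eq hb (fun i hi => snd_lt_of_mem hJ (hd.mem i hi))
      (fun i hi => snd_lt_of_mem hJ (he i hi)) hd.snd_ne_zero hd.snd_ne_pred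
      (congrArg Prod.snd h) i hi

theorem exists_shift {P : ℕ → Prop} (h : ∀ N, ∃ i, N < i ∧ P i) :
    ∀ N, ∃ i, N < i ∧ P (i + 1) := by
  intro N
  obtain ⟨i, hi, hi'⟩ := h (N + 1)
  exact ⟨i - 1, by lia, by rwa [Nat.sub_add_cancel (by lia)]⟩

theorem IsGeneric.shift (hd : IsGeneric b J d) : IsGeneric b J fun i => d (i + 1) where
  mem i _ := hd.mem _ (by lia)
  fst := hd.fst.imp_right fun h => ⟨exists_shift (P := fun i => (d i).1 ≠ 0) h.1,
    exists_shift (P := fun i => (d i).1 ≠ b - 1) h.2⟩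
  snd_ne_zero := exists_shift (P := fun i => (d i).2 ≠ 0) hd.snd_ne_zero
  snd_ne_pred := exists_shift (P := fun i => (d i).2 ≠ b - 1) hd.snd_ne_pred

theorem IsGeneric.Tmap_iterate (hb : 2 ≤ b) (hJ : J ⊆ Finset.range b ×ˢ Finset.range b)
    (R : RepMap b J) (hd : IsGeneric b J d) (n : ℕ) :
    (Tmap R)^[n] (point b d) = point b fun i => d (i + n) := by
  induction n generalizing d with
  | zero => rfl
  | succ n ih =>
    have hp := point_mem_carpet (b := b) hd.mem
    have h := hd.eq_of_point_eq hb hJ (R.mem_J _ hp) (point_rep R hp).symm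
    rw [Function.iterate_succ_apply, Tmap_eq_point hb hJ R hp,
      point_congr (e := fun i => d (i + 1)) fun i _ => (h (i + 1) (by lia)).symm, ih hd.shift]
    exact point_congr fun i _ => rfl

/-! ### Covering limsup sets -/

theorem hausdorffMeasure_limsup_eq_zero {X : Type*} [EMetricSpace X] [MeasurableSpace X]
    [BorelSpace X] {E : Set X} {V : ℕ → Set X} (hE : ∀ p ∈ E, ∃ᶠ n in atTop, p ∈ V n)
    {c : ℕ → ℕ} {r R : ℕ → ℝ} {s : ℝ} (hs : 0 ≤ s) (U : ∀ n, Fin (c n) → Set X)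
    (hU : ∀ n i, Metric.ediam (U n i) ≤ ENNReal.ofReal (r n))
    (hV : ∀ᶠ n in atTop, V n ⊆ ⋃ i, U n i)
    (hr : ∀ n, 0 ≤ r n) (hrR : ∀ n, r n ≤ R n) (hR : Antitone R) (hR0 : Tendsto R atTop (𝓝 0))
    (hsum : Summable fun n => (c n : ℝ) * r n ^ s) : μH[s] E = 0 := by
  have hle : μH[s] E ≤ liminf (fun N : ℕ =>
      ∑' q : (Σ n : ℕ, Fin (c (n + N))), Metric.ediam (U (q.1 + N) q.2) ^ s) atTop := by
    refine Measure.hausdorffMeasure_le_liminf_tsum (ι := fun N : ℕ => Σ n : ℕ, Fin (c (n + N)))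
      s E (fun N => ENNReal.ofReal (R N)) ?_ (fun N q => U (q.1 + N) q.2) ?_ ?_
    · simpa using ENNReal.tendsto_ofReal hR0
    · refine Eventually.of_forall fun N q => (hU _ _).trans (ENNReal.ofReal_le_ofReal ?_)
      exact (hrR _).trans (hR (by lia))
    · obtain ⟨N₀, hN₀⟩ := eventually_atTop.1 hV
      filter_upwards [eventually_ge_atTop N₀] with N hN p hp
      obtain ⟨n, hn, hpn⟩ := frequently_atTop.1 (hE p hp) N
      obtain ⟨i, hi⟩ := mem_iUnion.1 (hN₀ n (by lia) hpn)
      obtain ⟨k, rfl⟩ := Nat.exists_eq_add_of_le' hn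
      exact mem_iUnion.2 ⟨⟨k, i⟩, hi⟩
  have hlim : Tendsto (fun N : ℕ =>
      ∑' q : (Σ n : ℕ, Fin (c (n + N))), Metric.ediam (U (q.1 + N) q.2) ^ s) atTop (𝓝 0) := by
    have hfin : ∑' n, ENNReal.ofReal ((c n : ℝ) * r n ^ s) ≠ ∞ := hsum.tsum_ofReal_ne_top
    refine tendsto_of_tendsto_of_tendsto_of_le_of_le tendsto_const_nhds
      (ENNReal.tendsto_sum_nat_add _ hfin) (fun N => zero_le) fun N => ?_
    simp only
    rw [ENNReal.tsum_sigma']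
    refine ENNReal.tsum_le_tsum fun n => ?_
    rw [tsum_fintype]
    refine (Finset.sum_le_card_nsmul _ _ (ENNReal.ofReal (r (n + N)) ^ s) fun i _ =>
      ENNReal.rpow_le_rpow (hU _ _) hs).trans_eq ?_
    rw [Finset.card_univ, Fintype.card_fin, nsmul_eq_mul, ENNReal.ofReal_mul (by positivity),
      ENNReal.ofReal_natCast, ENNReal.ofReal_rpow_of_nonneg (hr _) hs]
  rw [hlim.liminf_eq] at hle
  exact le_antisymm hle zero_le

theorem summable_of_tendsto_log_div {f : ℕ → ℝ} (hf : ∀ n, 0 < f n) {κ : ℝ} (hκ : κ < 0)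
    (h : Tendsto (fun n : ℕ => Real.log (f n) / n) atTop (𝓝 κ)) : Summable f := by
  refine Summable.of_norm_bounded_eventually_nat (g := fun n : ℕ => Real.exp (κ / 2) ^ n)
    (summable_geometric_of_lt_one (Real.exp_pos _).le (Real.exp_lt_one_iff.2 (by linarith))) ?_
  filter_upwards [h.eventually_lt_const (show κ < κ / 2 by linarith), eventually_gt_atTop 0]
    with n hn hn0
  have hn0' : (0 : ℝ) < n := by exact_mod_cast hn0
  rw [Real.norm_of_nonneg (hf n).le, ← Real.exp_nat_mul, ← Real.log_le_iff_le_exp (hf n)]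
  rw [div_lt_iff₀ hn0'] at hn
  linarith

/-- The number of squares used to cover the points whose digits are free in `n` places, then
known up to a bounded ambiguity in `L` places, then of known row in `M` places, and free in
`k` places. -/
def coverCard (J : Finset (ℕ × ℕ)) (ω : ℕ → ℕ × ℕ) (n L M k : ℕ) : ℕ :=
  J.card ^ n * 25 * (∏ i ∈ Finset.range M, (J2 J (ω (L + i + 1)).2).card) * J.card ^ k

theorem exists_cover (hb : 2 ≤ b) (hJ : J ⊆ Finset.range b ×ˢ Finset.range b)
    (ω : ℕ → ℕ × ℕ) (n L M k : ℕ) (D : Set (ℕ → ℕ × ℕ))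
    (hD : ∀ d ∈ D, ∀ i, 1 ≤ i → d i ∈ J)
    (hx : ∀ d ∈ D, |(prefixVal b (fun i => (d (i + n)).1) L : ℤ) -
      prefixVal b (fun i => (ω i).1) L| ≤ 2)
    (hy : ∀ d ∈ D, |(prefixVal b (fun i => (d (i + n)).2) L : ℤ) -
      prefixVal b (fun i => (ω i).2) L| ≤ 2)
    (hrow : ∀ d ∈ D, ∀ i, i < M → (d (L + i + 1 + n)).2 = (ω (L + i + 1)).2) :
    ∃ U : Fin (coverCard J ω n L M k) → Set (ℝ × ℝ),
      (∀ i, Metric.ediam (U i) ≤ ENNReal.ofReal ((b : ℝ) ^ (n + L + M + k))⁻¹) ∧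
      point b '' D ⊆ ⋃ i, U i := by
  let ι := (Fin n → J) × (Finset.Icc (-2 : ℤ) 2 × Finset.Icc (-2 : ℤ) 2) ×
    ((i : Fin M) → J2 J (ω (L + i + 1)).2) × (Fin k → J)
  let code : D → ι := fun d =>
    (fun i => ⟨d.1 (i + 1), hD d d.2 _ (by lia)⟩,
      (⟨_, Finset.mem_Icc.2 (abs_le.1 (hx d d.2))⟩, ⟨_, Finset.mem_Icc.2 (abs_le.1 (hy d d.2))⟩),
      fun i => ⟨d.1 (L + i + 1 + n),
        Finset.mem_filter.2 ⟨hD d d.2 _ (by lia), hrow d d.2 i i.2⟩⟩,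
      fun i => ⟨d.1 (L + M + i + 1 + n), hD d d.2 _ (by lia)⟩)
  have h5 : (Finset.Icc (-2 : ℤ) 2).card = 5 := rfl
  have hcard : Fintype.card ι = coverCard J ω n L M k := by
    simp only [ι, coverCard, Fintype.card_prod, Fintype.card_pi, Fintype.card_coe,
      h5, Finset.prod_const, Finset.card_univ, Fintype.card_fin]
    rw [Finset.prod_range fun i => (J2 J (ω (L + i + 1)).2).card]
    ring
  have hcode : ∀ d d' : D, code d = code d' → ∀ i, 1 ≤ i → i ≤ n + L + M + k →
      d.1 i = d'.1 i := by
    intro d d' h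
    have h1 := congrArg Prod.fst h
    have h2 := congrArg (fun q : ι => q.2.1.1.1) h
    have h3 := congrArg (fun q : ι => q.2.1.2.1) h
    have h4 := congrArg (fun q : ι => q.2.2.1) h
    have h6 := congrArg (fun q : ι => q.2.2.2) h
    simp only [code, sub_left_inj, Nat.cast_inj] at h2 h3
    intro i hi hi'
    by_cases hin : i ≤ n
    · have := congrArg Subtype.val (congrFun h1 ⟨i - 1, by lia⟩)
      simpa [code, Nat.sub_add_cancel hi] using this
    by_cases hiL : i ≤ n + L
    · have e1 := eq_of_prefixVal_eq (fun j hj => fst_lt_of_mem hJ (hD d d.2 _ (by lia)))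
        (fun j hj => fst_lt_of_mem hJ (hD d' d'.2 _ (by lia))) h2 (i - n) (by lia) (by lia)
      have e2 := eq_of_prefixVal_eq (fun j hj => snd_lt_of_mem hJ (hD d d.2 _ (by lia)))
        (fun j hj => snd_lt_of_mem hJ (hD d' d'.2 _ (by lia))) h3 (i - n) (by lia) (by lia)
      simp only [Nat.sub_add_cancel (not_le.1 hin).le] at e1 e2
      exact Prod.ext e1 e2
    by_cases hiM : i ≤ n + L + M
    · have := congrArg Subtype.val (congrFun h4 ⟨i - (n + L + 1), by lia⟩)
      simpa [code, show L + (i - (n + L + 1)) + 1 + n = i by lia] using this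
    · have := congrArg Subtype.val (congrFun h6 ⟨i - (n + L + M + 1), by lia⟩)
      simpa [code, show L + M + (i - (n + L + M + 1)) + 1 + n = i by lia] using this
  let f := Fintype.equivFinOfCardEq hcard
  refine ⟨fun i => {p | ∃ d : D, code d = f.symm i ∧ p = point b d.1}, fun i => ?_, ?_⟩
  · refine Metric.ediam_le ?_
    rintro _ ⟨d, hd, rfl⟩ _ ⟨d', hd', rfl⟩
    exact edist_point_le hb hJ (hD d d.2) (hD d' d'.2) (hcode d d' (hd.trans hd'.symm))
  · rintro _ ⟨d, hd, rfl⟩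
    exact mem_iUnion.2 ⟨f (code ⟨d, hd⟩), ⟨d, hd⟩, by simp, rfl⟩

/-! ### Digit frequencies -/

theorem freqCount_succ (u : ℕ → ℕ) (a n : ℕ) :
    freqCount u a (n + 1) = freqCount u a n + if u (n + 1) = a then 1 else 0 := by
  unfold freqCount
  rw [← Finset.insert_Icc_right_eq_Icc_add_one (by lia), Finset.filter_insert]
  split_ifs with h
  · rw [Finset.card_insert_of_notMem (by simp)]
  · rfl

theorem freqCount_eq_add {a m n : ℕ} (hmn : m ≤ n) (h : ∀ i, m < i → i ≤ n → u i = a) :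
    freqCount u a n = freqCount u a m + (n - m) := by
  induction n, hmn using Nat.le_induction with
  | base => simp
  | succ n hmn ih =>
    rw [freqCount_succ, ih fun i h1 h2 => h i h1 (by lia), if_pos (h (n + 1) (by lia) le_rfl)]
    lia

theorem tendsto_comp_div {F : ℕ → ℝ} {c : ℝ} (hF : Tendsto (fun n : ℕ => F n / n) atTop (𝓝 c))
    {α : ℕ → ℕ} {α' : ℝ} (hα : Tendsto (fun n : ℕ => (α n : ℝ) / n) atTop (𝓝 α'))
    (hα_top : Tendsto α atTop atTop) :
    Tendsto (fun n : ℕ => F (α n) / n) atTop (𝓝 (c * α')) := by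
  refine ((hF.comp hα_top).mul hα).congr' ?_
  filter_upwards [hα_top.eventually_gt_atTop 0] with n hn
  have : (α n : ℝ) ≠ 0 := by exact_mod_cast hn.ne'
  simp only [Function.comp]
  field_simp

theorem eventually_exists_digit_ne {a : ℕ} {q : ℝ} (hq : q < 1)
    (hu : Tendsto (fun n : ℕ => (freqCount u a n : ℝ) / n) atTop (𝓝 q))
    {α β : ℕ → ℕ} {α' β' : ℝ} (hαβ : α' < β')
    (hα : Tendsto (fun n : ℕ => (α n : ℝ) / n) atTop (𝓝 α'))
    (hβ : Tendsto (fun n : ℕ => (β n : ℝ) / n) atTop (𝓝 β'))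
    (hα_top : Tendsto α atTop atTop) (hβ_top : Tendsto β atTop atTop) :
    ∀ᶠ n in atTop, ∃ i, α n < i ∧ i ≤ β n ∧ u i ≠ a := by
  have h1 := (tendsto_comp_div hu hβ hβ_top).sub (tendsto_comp_div hu hα hα_top)
  have h2 := hβ.sub hα
  filter_upwards [h1.eventually_lt h2 (by nlinarith), hα.eventually_lt hβ hαβ,
    eventually_gt_atTop 0] with n hn hlt hn0
  have hn0' : (0 : ℝ) < n := by exact_mod_cast hn0
  by_contra! hcon
  have hle : α n ≤ β n := by
    have := (div_lt_div_iff_of_pos_right hn0').1 hlt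
    exact_mod_cast this.le
  rw [freqCount_eq_add hle hcon] at hn
  push_cast [Nat.cast_sub hle] at hn
  rw [← sub_div, ← sub_div] at hn
  have := (div_lt_div_iff_of_pos_right hn0').1 hn
  linarith

/-- The logarithm of the number of words of length `m` with the rows of `ω`. -/
def rowSum (J : Finset (ℕ × ℕ)) (ω : ℕ → ℕ × ℕ) (m : ℕ) : ℝ :=
  ∑ i ∈ Finset.range m, Real.log (J2 J (ω (i + 1)).2).card

theorem rowSum_eq_sum_freqCount {J : Finset (ℕ × ℕ)} {ω : ℕ → ℕ × ℕ}
    (hω : ∀ i, 1 ≤ i → (ω i).2 < b) (m : ℕ) :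
    rowSum J ω m = ∑ a ∈ Finset.range b,
      (freqCount (fun i => (ω i).2) a m : ℝ) * Real.log (J2 J a).card := by
  induction m with
  | zero => simp [rowSum, freqCount]
  | succ m ih =>
    rw [rowSum, Finset.sum_range_succ, ← rowSum, ih]
    simp only [freqCount_succ, Nat.cast_add, add_mul, Finset.sum_add_distrib]
    congr 1
    simp [hω (m + 1) (by lia)]

theorem tendsto_rowSum_div {J : Finset (ℕ × ℕ)} {ω : ℕ → ℕ × ℕ}
    (hω : ∀ i, 1 ≤ i → (ω i).2 < b) {p : ℕ → ℝ}
    (hp : ∀ a, a < b →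
      Tendsto (fun n : ℕ => (freqCount (fun i => (ω i).2) a n : ℝ) / n) atTop (𝓝 (p a))) :
    Tendsto (fun m : ℕ => rowSum J ω m / m) atTop
      (𝓝 (∑ a ∈ Finset.range b, p a * Real.log (J2 J a).card)) := by
  have := tendsto_finsetSum (Finset.range b) fun a ha =>
    (hp a (Finset.mem_range.1 ha)).mul_const (Real.log (J2 J a).card)
  refine this.congr fun m => ?_
  rw [rowSum_eq_sum_freqCount hω, Finset.sum_div]
  exact Finset.sum_congr rfl fun a _ => by ring

/-! ### The upper bound -/

theorem log_coverCard_mul {J : Finset (ℕ × ℕ)} {ω : ℕ → ℕ × ℕ} (hb : 2 ≤ b)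
    (hω : ∀ i, 1 ≤ i → ω i ∈ J) (n L M k : ℕ) (s : ℝ) :
    0 < (coverCard J ω n L M k : ℝ) * ((b : ℝ) ^ (n + L + M + k))⁻¹ ^ s ∧
    Real.log ((coverCard J ω n L M k : ℝ) * ((b : ℝ) ^ (n + L + M + k))⁻¹ ^ s) =
      n * Real.log J.card + Real.log 25 + (rowSum J ω (L + M) - rowSum J ω L) +
        k * Real.log J.card - s * ((n + (L + M : ℕ) + k) * Real.log b) := by
  have hb' : (0 : ℝ) < b := by exact_mod_cast (by lia : 0 < b)
  have hJ0 : (0 : ℝ) < J.card := by exact_mod_cast Finset.card_pos.2 ⟨_, hω 1 le_rfl⟩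
  have hrow : ∀ i, (0 : ℝ) < (J2 J (ω (L + i + 1)).2).card := fun i =>
    Nat.cast_pos.2 (Finset.card_pos.2
      ⟨ω (L + i + 1), Finset.mem_filter.2 ⟨hω (L + i + 1) (by lia), rfl⟩⟩)
  have hprod : (0 : ℝ) < ∏ i ∈ Finset.range M, ((J2 J (ω (L + i + 1)).2).card : ℝ) :=
    Finset.prod_pos fun i _ => hrow i
  have hpow : (0 : ℝ) < ((b : ℝ) ^ (n + L + M + k))⁻¹ := by positivity
  have hc : (0 : ℝ) < coverCard J ω n L M k := by
    unfold coverCard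
    push_cast
    positivity
  refine ⟨mul_pos hc (Real.rpow_pos_of_pos hpow s), ?_⟩
  rw [Real.log_mul hc.ne' (Real.rpow_pos_of_pos hpow s).ne', Real.log_rpow hpow, Real.log_inv,
    Real.log_pow]
  have hcard : Real.log (coverCard J ω n L M k) = n * Real.log J.card + Real.log 25 +
      (rowSum J ω (L + M) - rowSum J ω L) + k * Real.log J.card := by
    unfold coverCard
    push_cast
    rw [Real.log_mul (by positivity) (by positivity), Real.log_mul (by positivity) hprod.ne',
      Real.log_mul (by positivity) (by norm_num), Real.log_pow, Real.log_pow,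
      Real.log_prod fun i _ => (hrow i).ne', rowSum, rowSum, Finset.sum_range_add]
    simp
  rw [hcard]
  push_cast
  ring

theorem hausdorffMeasure_targetSet_eq_zero {J : Finset (ℕ × ℕ)} (hb : 2 ≤ b)
    (hJ : J ⊆ Finset.range b ×ˢ Finset.range b) (R : RepMap b J) {lam xi : ℕ → ℕ}
    (hle : ∀ n, lam n ≤ xi n) {ω : ℕ → ℕ × ℕ} (hω : ∀ i, 1 ≤ i → ω i ∈ J) {z w : ℝ}
    (hzw : point b ω = (z, w)) {M k : ℕ → ℕ} {s κ : ℝ} (hs : 0 ≤ s)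
    (hrow : ∀ᶠ n in atTop, ∀ v : ℕ → ℕ, (∀ i, 1 ≤ i → v i < b) →
      |w - val b v| ≤ ((b : ℝ) ^ xi n)⁻¹ →
      ∀ i, i < M n → v (lam n + i + 1) = (ω (lam n + i + 1)).2)
    (hκ : κ < 0)
    (hlim : Tendsto (fun n : ℕ => (n * Real.log J.card + Real.log 25 +
      (rowSum J ω (lam n + M n) - rowSum J ω (lam n)) + k n * Real.log J.card -
        s * ((n + (lam n + M n : ℕ) + k n) * Real.log b)) / n) atTop (𝓝 κ)) :
    μH[s] (targetSet R lam xi z w) = 0 := by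
  have hb' : (2 : ℝ) ≤ b := by exact_mod_cast hb
  have hz : val b (fun i => (ω i).1) = z := congrArg Prod.fst hzw
  have hw : val b (fun i => (ω i).2) = w := congrArg Prod.snd hzw
  let D : ℕ → Set (ℕ → ℕ × ℕ) := fun n => {d | (∀ i, 1 ≤ i → d i ∈ J) ∧
    |z - val b (fun i => (d (i + n)).1)| ≤ ((b : ℝ) ^ lam n)⁻¹ ∧
    |w - val b (fun i => (d (i + n)).2)| ≤ ((b : ℝ) ^ xi n)⁻¹}
  have hE : ∀ p ∈ targetSet R lam xi z w, ∃ᶠ n in atTop, p ∈ point b '' D n := by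
    rintro p ⟨hp, hfreq⟩
    refine hfreq.mono fun n hn => ?_
    obtain ⟨d, hd, hpd, hdn⟩ := exists_digits_of_Tmap_iterate hb hJ R n hp
    rw [hdn] at hn
    refine ⟨d, ⟨hd, ?_, ?_⟩, hpd.symm⟩
    · have := hn.1
      rw [zpow_neg, zpow_natCast, ← Real.closedBall_eq_Icc, Metric.mem_closedBall, dist_comm,
        Real.dist_eq] at this
      exact this
    · have := hn.2
      rw [zpow_neg, zpow_natCast, ← Real.closedBall_eq_Icc, Metric.mem_closedBall, dist_comm,
        Real.dist_eq] at this
      exact this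
  have hnear : ∀ (n : ℕ) (u v : ℕ → ℕ), (∀ i, 1 ≤ i → u i < b) → (∀ i, 1 ≤ i → v i < b) →
      |val b u - val b v| ≤ ((b : ℝ) ^ lam n)⁻¹ →
      |(prefixVal b v (lam n) : ℤ) - prefixVal b u (lam n)| ≤ 2 := by
    intro n u v hu hv h
    rw [abs_sub_comm]
    refine abs_prefixVal_sub_le hb hu hv (c := 2) (h.trans_lt ?_)
    have : (0 : ℝ) < ((b : ℝ) ^ lam n)⁻¹ := by positivity
    push_cast
    linarith
  have hcover : ∀ n, ∃ U : Fin (coverCard J ω n (lam n) (M n) (k n)) → Set (ℝ × ℝ),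
      (∀ i, Metric.ediam (U i) ≤ ENNReal.ofReal ((b : ℝ) ^ (n + lam n + M n + k n))⁻¹) ∧
      ((∀ d ∈ D n, ∀ i, i < M n → (d (lam n + i + 1 + n)).2 = (ω (lam n + i + 1)).2) →
        point b '' D n ⊆ ⋃ i, U i) := by
    intro n
    by_cases h : ∀ d ∈ D n, ∀ i, i < M n → (d (lam n + i + 1 + n)).2 = (ω (lam n + i + 1)).2
    · obtain ⟨U, hU1, hU2⟩ := exists_cover hb hJ ω n (lam n) (M n) (k n) (D n)
        (fun d hd => hd.1)
        (fun d hd => hnear n (fun i => (ω i).1) (fun i => (d (i + n)).1)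
          (fun i hi => fst_lt_of_mem hJ (hω i hi))
          (fun i hi => fst_lt_of_mem hJ (hd.1 _ (by lia))) (hz ▸ hd.2.1))
        (fun d hd => hnear n (fun i => (ω i).2) (fun i => (d (i + n)).2)
          (fun i hi => snd_lt_of_mem hJ (hω i hi))
          (fun i hi => snd_lt_of_mem hJ (hd.1 _ (by lia))) (hw ▸ hd.2.2.trans (by
            have := hle n
            gcongr
            linarith))) h
      exact ⟨U, hU1, fun _ => hU2⟩
    · exact ⟨fun _ => ∅, by simp, fun h' => absurd h' h⟩
  choose U hU hDU using hcover
  refine hausdorffMeasure_limsup_eq_zero hE (r := fun n => ((b : ℝ) ^ (n + lam n + M n + k n))⁻¹)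
    (R := fun n => ((b : ℝ) ^ n)⁻¹) hs U hU ?_ (fun n => by positivity) ?_ ?_ ?_ ?_
  · filter_upwards [hrow] with n hn
    exact hDU n fun d hd => hn (fun i => (d (i + n)).2)
      (fun i hi => snd_lt_of_mem hJ (hd.1 _ (by lia))) hd.2.2
  · intro n
    gcongr
    · linarith
    · lia
  · intro m n hmn
    simp only
    gcongr
    linarith
  · exact tendsto_inv_atTop_zero.comp (tendsto_pow_atTop_atTop_of_one_lt (by linarith))
  · refine summable_of_tendsto_log_div (fun n => (log_coverCard_mul hb hω _ _ _ _ s).1) hκ ?_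
    simpa only [(log_coverCard_mul hb hω _ _ _ _ s).2] using hlim

theorem hausdorffMeasure_targetSet_eq_zero_of_div_lt {J : Finset (ℕ × ℕ)} (hb : 2 ≤ b)
    (hJ : J ⊆ Finset.range b ×ˢ Finset.range b) (R : RepMap b J) {lam xi : ℕ → ℕ}
    (hle : ∀ n, lam n ≤ xi n) {ω : ℕ → ℕ × ℕ} (hω : ∀ i, 1 ≤ i → ω i ∈ J) {z w : ℝ}
    (hzw : point b ω = (z, w)) {l : ℝ} (hl0 : 0 ≤ l)
    (hl : Tendsto (fun n : ℕ => (lam n : ℝ) / n) atTop (𝓝 l)) {s : ℝ} (hs : 0 ≤ s)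
    (h : (Real.log J.card / Real.log b) / (1 + l) < s) :
    μH[s] (targetSet R lam xi z w) = 0 := by
  have hlogb : 0 < Real.log b := Real.log_pos (by exact_mod_cast (by lia : 1 < b))
  rw [div_lt_iff₀ (by linarith), div_lt_iff₀ hlogb] at h
  refine hausdorffMeasure_targetSet_eq_zero hb hJ R hle hω hzw (M := fun _ => 0)
    (k := fun _ => 0) hs (by simp)
    (κ := Real.log J.card + Real.log 25 * 0 - s * ((1 + l) * Real.log b)) (by linarith) ?_
  refine ((tendsto_const_nhds.add (tendsto_one_div_atTop_nhds_zero_nat.const_mul _)).sub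
    (((hl.const_add 1).mul_const (Real.log b)).const_mul s)).congr' ?_
  filter_upwards [eventually_gt_atTop 0] with n hn
  have : (n : ℝ) ≠ 0 := by exact_mod_cast hn.ne'
  simp only [add_zero, sub_self, Nat.cast_zero, zero_mul]
  field_simp

theorem hausdorffMeasure_targetSet_eq_zero_of_add_div_lt {J : Finset (ℕ × ℕ)} (hb : 2 ≤ b)
    (hJ : J ⊆ Finset.range b ×ˢ Finset.range b) (R : RepMap b J) {lam xi : ℕ → ℕ}
    (hle : ∀ n, lam n ≤ xi n) (hlam_top : Tendsto lam atTop atTop) {ω : ℕ → ℕ × ℕ}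
    (hω : ∀ i, 1 ≤ i → ω i ∈ J) {z w : ℝ} (hzw : point b ω = (z, w)) {l x : ℝ} (hl0 : 0 ≤ l)
    (hlx : l < x) (hl : Tendsto (fun n : ℕ => (lam n : ℝ) / n) atTop (𝓝 l))
    (hx : Tendsto (fun n : ℕ => (xi n : ℝ) / n) atTop (𝓝 x))
    {p0 p1 : ℝ} (hp0 : p0 < 1) (hp1 : p1 < 1)
    (hfreq0 : Tendsto (fun n : ℕ => (freqCount (fun i => (ω i).2) 0 n : ℝ) / n) atTop (𝓝 p0))
    (hfreq1 : Tendsto (fun n : ℕ => (freqCount (fun i => (ω i).2) (b - 1) n : ℝ) / n) atTop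
      (𝓝 p1))
    {h : ℝ} (hrow : Tendsto (fun m : ℕ => rowSum J ω m / m) atTop (𝓝 h)) {s : ℝ} (hs : 0 ≤ s)
    (hlt : (Real.log J.card / Real.log b + (x - l) * (h / Real.log b)) / (1 + x) < s) :
    μH[s] (targetSet R lam xi z w) = 0 := by
  have hb' : (2 : ℝ) ≤ b := by exact_mod_cast hb
  have hlogb : 0 < Real.log b := Real.log_pos (by linarith)
  have hw : val b (fun i => (ω i).2) = w := congrArg Prod.snd hzw
  have hxi_top : Tendsto xi atTop atTop := tendsto_atTop_mono hle hlam_top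
  rw [div_lt_iff₀ (by linarith), ← mul_div_assoc, ← add_div, div_lt_iff₀ hlogb] at hlt
  set g := Real.log J.card with hg
  obtain ⟨δ, ⟨hδ0, hδ1⟩, hδ⟩ : ∃ δ, δ ∈ Ioo 0 (x - l) ∧
      (g + (x - l) * h - s * ((1 + x) * Real.log b)) + δ * (g - h) < 0 := by
    have hc : Tendsto (fun δ : ℝ => (g + (x - l) * h - s * ((1 + x) * Real.log b)) + δ * (g - h))
        (𝓝[>] 0) (𝓝 ((g + (x - l) * h - s * ((1 + x) * Real.log b)) + 0 * (g - h))) :=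
      (Continuous.tendsto (by fun_prop) 0).mono_left nhdsWithin_le_nhds
    have h1 := hc.eventually_lt_const (u := 0) (by linarith)
    have h0 : ∀ᶠ δ in 𝓝[>] (0 : ℝ), δ ∈ Ioo 0 (x - l) := Ioo_mem_nhdsGT (by linarith)
    exact (h0.and h1).exists
  let k : ℕ → ℕ := fun n => ⌊δ * n⌋₊
  have hk : Tendsto (fun n : ℕ => (k n : ℝ) / n) atTop (𝓝 δ) :=
    (tendsto_nat_floor_mul_div_atTop hδ0.le).comp tendsto_natCast_atTop_atTop
  have hk_le : ∀ᶠ n in atTop, lam n + k n < xi n := by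
    filter_upwards [(hl.add hk).eventually_lt hx (by linarith), eventually_gt_atTop 0]
      with n hn hn0
    have hn0' : (0 : ℝ) < n := by exact_mod_cast hn0
    rw [← add_div, div_lt_div_iff_of_pos_right hn0'] at hn
    exact_mod_cast hn
  have hj : Tendsto (fun n : ℕ => ((xi n - k n : ℕ) : ℝ) / n) atTop (𝓝 (x - δ)) := by
    refine (hx.sub hk).congr' ?_
    filter_upwards [hk_le] with n hn
    rw [Nat.cast_sub (by lia), sub_div]
  have hj_top : Tendsto (fun n => xi n - k n) atTop atTop := by
    refine tendsto_atTop_mono' _ ?_ hlam_top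
    filter_upwards [hk_le] with n hn
    lia
  have hq : Tendsto (fun n : ℕ => ((xi n - 1 : ℕ) : ℝ) / n) atTop (𝓝 (x - 0)) := by
    refine (hx.sub tendsto_one_div_atTop_nhds_zero_nat).congr' ?_
    filter_upwards [hk_le] with n hn
    rw [Nat.cast_sub (by lia), sub_div, Nat.cast_one]
  have hq_top : Tendsto (fun n => xi n - 1) atTop atTop :=
    (tendsto_sub_atTop_nat 1).comp hxi_top
  refine hausdorffMeasure_targetSet_eq_zero hb hJ R hle hω hzw
    (M := fun n => xi n - k n - lam n) (k := k) hs ?_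
    (κ := g + Real.log 25 * 0 + (h * (x - δ) - h * l) + δ * g - s * ((1 + x) * Real.log b))
    (by linarith) ?_
  · filter_upwards [hk_le, (tendsto_order.1 hk).1 0 hδ0,
      eventually_exists_digit_ne hp0 hfreq0 (by linarith) hj hq hj_top hq_top,
      eventually_exists_digit_ne hp1 hfreq1 (by linarith) hj hq hj_top hq_top]
      with n hn hkn h0 h1 v hv hwv i hi
    have hk1 : 1 ≤ k n := by
      by_contra! hk0
      have : k n = 0 := by lia
      simp [this] at hkn
    refine (digits_eq_of_abs_val_sub_lt hb (u := fun i => (ω i).2)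
      (fun i hi => snd_lt_of_mem hJ (hω i hi)) hv (by lia) h0 h1 ?_ _ (by lia) (by lia)).symm
    rw [hw]
    refine hwv.trans_lt ?_
    gcongr
    · linarith
    · lia
  · refine ((((tendsto_const_nhds.add (tendsto_one_div_atTop_nhds_zero_nat.const_mul _)).add
      ((tendsto_comp_div hrow hj hj_top).sub (tendsto_comp_div hrow hl hlam_top))).add
      (hk.mul_const g)).sub (((hx.const_add 1).mul_const (Real.log b)).const_mul s)).congr' ?_
    filter_upwards [hk_le, eventually_gt_atTop 0] with n hn hn0
    have : (n : ℝ) ≠ 0 := by exact_mod_cast hn0.ne'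
    have e1 : lam n + (xi n - k n - lam n) = xi n - k n := by lia
    have e2 : ((xi n - k n : ℕ) : ℝ) = xi n - k n := Nat.cast_sub (by lia)
    rw [e1, e2]
    field_simp
    ring

/-! ### Mass distribution on sets with prescribed digit alphabets -/

/-- The digit sequence of an element of a product of finite alphabets. -/
def digitSeq {A : ℕ → Finset (ℕ × ℕ)} (σ : (i : ℕ) → A i) (i : ℕ) : ℕ × ℕ := σ i

theorem continuous_val {X : Type*} [TopologicalSpace X] (hb : 2 ≤ b) {f : X → ℕ → ℕ}
    (hf : ∀ i, Continuous fun x => f x i) (hlt : ∀ x i, f x i < b) :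
    Continuous fun x => val b (f x) := by
  have hb' : (2 : ℝ) ≤ b := by exact_mod_cast hb
  refine continuous_tsum (u := fun i : ℕ => ((b - 1 : ℕ) : ℝ) / (b : ℝ) ^ (i + 1)) (fun i => ?_)
    (summable_digits hb (u := fun _ => b - 1) fun _ _ => by lia) fun i x => ?_
  · exact (continuous_of_discreteTopology.comp (hf (i + 1))).div_const _
  · rw [Real.norm_of_nonneg (by positivity)]
    have : f x (i + 1) ≤ b - 1 := by have := hlt x (i + 1); lia
    gcongr

theorem continuous_point {J : Finset (ℕ × ℕ)} (hb : 2 ≤ b)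
    (hJ : J ⊆ Finset.range b ×ˢ Finset.range b) {A : ℕ → Finset (ℕ × ℕ)} (hAJ : ∀ i, A i ⊆ J) :
    Continuous fun σ : (i : ℕ) → A i => point b (digitSeq σ) := by
  have h : ∀ i, Continuous fun σ : (i : ℕ) → A i => digitSeq σ i := fun i =>
    continuous_subtype_val.comp (continuous_apply i)
  exact (continuous_val hb (fun i => continuous_fst.comp (h i))
    fun σ i => fst_lt_of_mem hJ (hAJ i (σ i).2)).prodMk
      (continuous_val hb (fun i => continuous_snd.comp (h i))
        fun σ i => snd_lt_of_mem hJ (hAJ i (σ i).2))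

/-- The uniform probability measure on a product of finite alphabets. -/
def uniformProduct (A : ℕ → Finset (ℕ × ℕ)) [∀ i, Nonempty (A i)] : Measure ((i : ℕ) → A i) :=
  Measure.infinitePi fun i => (PMF.uniformOfFintype (A i)).toMeasure

instance (A : ℕ → Finset (ℕ × ℕ)) [∀ i, Nonempty (A i)] :
    IsProbabilityMeasure (uniformProduct A) := by
  unfold uniformProduct
  infer_instance

theorem uniformProduct_cylinder_le (A : ℕ → Finset (ℕ × ℕ)) [∀ i, Nonempty (A i)]
    (τ : (i : ℕ) → A i) (m : ℕ) (E : Set ((i : ℕ) → A i))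
    (hE : ∀ σ ∈ E, ∀ i, 1 ≤ i → i ≤ m → σ i = τ i) :
    uniformProduct A E ≤ ENNReal.ofReal (∏ i ∈ Finset.Icc 1 m, ((A i).card : ℝ)⁻¹) := by
  have hsub : E ⊆ Set.pi (Finset.Icc 1 m : Finset ℕ) fun i => {τ i} := by
    intro σ hσ i hi
    obtain ⟨h1, h2⟩ := Finset.mem_Icc.1 (Finset.mem_coe.1 hi)
    exact hE σ hσ i h1 h2
  refine (measure_mono hsub).trans_eq ?_
  rw [uniformProduct, Measure.infinitePi_pi _ fun i _ => measurableSet_singleton _,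
    ENNReal.ofReal_prod_of_nonneg fun i _ => by positivity]
  refine Finset.prod_congr rfl fun i _ => ?_
  have h0 : 0 < (A i).card := Finset.card_pos.2 (Finset.nonempty_coe_sort.1 inferInstance)
  rw [PMF.toMeasure_uniformOfFintype_apply _ (measurableSet_singleton _),
    ENNReal.ofReal_inv_of_pos (by exact_mod_cast h0)]
  simp

theorem uniformProduct_preimage_le {J : Finset (ℕ × ℕ)} (hb : 2 ≤ b)
    (hJ : J ⊆ Finset.range b ×ˢ Finset.range b) {A : ℕ → Finset (ℕ × ℕ)} [∀ i, Nonempty (A i)]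
    (hAJ : ∀ i, A i ⊆ J) (m : ℕ) (E : Set (ℝ × ℝ))
    (hE : Metric.ediam E ≤ ENNReal.ofReal ((b : ℝ) ^ m)⁻¹) :
    uniformProduct A ((fun σ => point b (digitSeq σ)) ⁻¹' E) ≤
      25 * ENNReal.ofReal (∏ i ∈ Finset.Icc 1 m, ((A i).card : ℝ)⁻¹) := by
  have hb' : (2 : ℝ) ≤ b := by exact_mod_cast hb
  rcases Set.eq_empty_or_nonempty ((fun σ : (i : ℕ) → A i => point b (digitSeq σ)) ⁻¹' E)
    with h0 | ⟨σ₀, hσ₀⟩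
  · rw [h0]; simp
  have hfst : ∀ (σ : (i : ℕ) → A i) i, 1 ≤ i → (digitSeq σ i).1 < b := fun σ i _ =>
    fst_lt_of_mem hJ (hAJ i (σ i).2)
  have hsnd : ∀ (σ : (i : ℕ) → A i) i, 1 ≤ i → (digitSeq σ i).2 < b := fun σ i _ =>
    snd_lt_of_mem hJ (hAJ i (σ i).2)
  let X : ((i : ℕ) → A i) → ℤ := fun σ => prefixVal b (fun i => (digitSeq σ i).1) m
  let Y : ((i : ℕ) → A i) → ℤ := fun σ => prefixVal b (fun i => (digitSeq σ i).2) m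
  let I : Finset (ℤ × ℤ) := Finset.Icc (-2) 2 ×ˢ Finset.Icc (-2) 2
  have hcover : (fun σ : (i : ℕ) → A i => point b (digitSeq σ)) ⁻¹' E ⊆
      ⋃ q ∈ I, {σ | X σ - X σ₀ = q.1 ∧ Y σ - Y σ₀ = q.2} := by
    intro σ hσ
    have hdist := (Metric.edist_le_ediam_of_mem (s := E) hσ hσ₀).trans hE
    rw [edist_dist, ENNReal.ofReal_le_ofReal_iff (by positivity), Prod.dist_eq, max_le_iff,
      Real.dist_eq, Real.dist_eq] at hdist
    have hpos : 0 < ((b : ℝ) ^ m)⁻¹ := by positivity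
    have h1 := abs_prefixVal_sub_le hb (hfst σ) (hfst σ₀) (m := m) (c := 2)
      (hdist.1.trans_lt (by push_cast; linarith))
    have h2 := abs_prefixVal_sub_le hb (hsnd σ) (hsnd σ₀) (m := m) (c := 2)
      (hdist.2.trans_lt (by push_cast; linarith))
    rw [abs_le] at h1 h2
    simp only [mem_iUnion]
    exact ⟨(X σ - X σ₀, Y σ - Y σ₀), Finset.mem_product.2
      ⟨Finset.mem_Icc.2 h1, Finset.mem_Icc.2 h2⟩, rfl, rfl⟩
  have hbound : ∀ q : ℤ × ℤ, uniformProduct A {σ | X σ - X σ₀ = q.1 ∧ Y σ - Y σ₀ = q.2} ≤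
      ENNReal.ofReal (∏ i ∈ Finset.Icc 1 m, ((A i).card : ℝ)⁻¹) := by
    intro q
    rcases Set.eq_empty_or_nonempty {σ | X σ - X σ₀ = q.1 ∧ Y σ - Y σ₀ = q.2} with hq | ⟨τ, hτ⟩
    · rw [hq]; simp
    refine uniformProduct_cylinder_le A τ m _ fun σ hσ i h1 h2 => ?_
    have hX : X σ = X τ := by linarith [hσ.1, hτ.1]
    have hY : Y σ = Y τ := by linarith [hσ.2, hτ.2]
    exact Subtype.ext (Prod.ext
      (eq_of_prefixVal_eq (hfst σ) (hfst τ) (Int.ofNat_inj.1 hX) i h1 h2)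
      (eq_of_prefixVal_eq (hsnd σ) (hsnd τ) (Int.ofNat_inj.1 hY) i h1 h2))
  calc _ ≤ _ := measure_mono hcover
    _ ≤ _ := measure_biUnion_finset_le _ _
    _ ≤ _ := Finset.sum_le_card_nsmul _ _ _ fun q _ => hbound q
    _ = _ := by simp [I]

theorem prod_inv_card_le {A : ℕ → Finset (ℕ × ℕ)} [∀ i, Nonempty (A i)] {δ : ℝ} {m : ℕ}
    (hb : 2 ≤ b)
    (hA : δ * Real.log b * m ≤ ∑ i ∈ Finset.range m, Real.log (A (i + 1)).card) :
    ∏ i ∈ Finset.Icc 1 m, ((A i).card : ℝ)⁻¹ ≤ ((b : ℝ) ^ m)⁻¹ ^ δ := by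
  have hb' : (0 : ℝ) < b := by exact_mod_cast (by lia : 0 < b)
  have hpos : ∀ i, (0 : ℝ) < (A i).card := fun i => by
    exact_mod_cast Finset.card_pos.2 (Finset.nonempty_coe_sort.1 inferInstance)
  rw [← Real.log_le_log_iff (Finset.prod_pos fun i _ => inv_pos.2 (hpos i)) (by positivity),
    Real.log_prod fun i _ => (inv_pos.2 (hpos i)).ne', Real.log_rpow (by positivity),
    Real.log_inv, Real.log_pow]
  have h : ∑ i ∈ Finset.range m, Real.log (A (i + 1)).card =
      ∑ i ∈ Finset.Icc 1 m, Real.log (A i).card := by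
    rw [Finset.range_eq_Ico, Finset.sum_Ico_add' (fun i => Real.log (A i).card) 0 m 1]
    rfl
  simp only [Real.log_inv, Finset.sum_neg_distrib]
  linarith

theorem hausdorffMeasure_ne_zero_of_alphabets {J : Finset (ℕ × ℕ)} (hb : 2 ≤ b)
    (hJ : J ⊆ Finset.range b ×ˢ Finset.range b) {A : ℕ → Finset (ℕ × ℕ)}
    (hne : ∀ i, (A i).Nonempty) (hAJ : ∀ i, A i ⊆ J) {δ : ℝ} (hδ : 0 < δ)
    (hA : ∀ m : ℕ, δ * Real.log b * m ≤ ∑ i ∈ Finset.range m, Real.log (A (i + 1)).card)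
    {E : Set (ℝ × ℝ)} (hE : ∀ d : ℕ → ℕ × ℕ, (∀ i, d i ∈ A i) → point b d ∈ E) :
    μH[δ] E ≠ 0 := by
  have hb' : (2 : ℝ) ≤ b := by exact_mod_cast hb
  have : ∀ i, Nonempty (A i) := fun i => (hne i).to_subtype
  have hπ := (continuous_point hb hJ hAJ).measurable
  set μ := (uniformProduct A).map fun σ => point b (digitSeq σ) with hμ
  have hball : ∀ (s : Set (ℝ × ℝ)) (m : ℕ), Metric.ediam s ≤ ENNReal.ofReal ((b : ℝ) ^ m)⁻¹ →
      μ s ≤ ENNReal.ofReal (25 * ((b : ℝ) ^ m)⁻¹ ^ δ) := by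
    intro s m hs
    calc μ s ≤ μ (closure s) := measure_mono subset_closure
      _ = _ := Measure.map_apply hπ isClosed_closure.measurableSet
      _ ≤ _ := uniformProduct_preimage_le hb hJ hAJ m _ (by rwa [Metric.ediam_closure])
      _ ≤ _ := by
        rw [ENNReal.ofReal_mul (by norm_num), ENNReal.ofReal_ofNat]
        gcongr
        exact prod_inv_card_le hb (hA m)
  have hc0 : 0 < 25 * (b : ℝ) ^ δ := by positivity
  set c := ENNReal.ofReal (25 * (b : ℝ) ^ δ) with hc
  have hle : c⁻¹ • μ ≤ μH[δ] := by
    refine Measure.le_hausdorffMeasure δ _ 1 one_pos fun s hs => ?_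
    have hfin : Metric.ediam s ≠ ∞ := (hs.trans_lt ENNReal.one_lt_top).ne
    obtain ⟨r, hr0, hr⟩ : ∃ r : ℝ, 0 ≤ r ∧ Metric.ediam s = ENNReal.ofReal r :=
      ⟨_, ENNReal.toReal_nonneg, (ENNReal.ofReal_toReal hfin).symm⟩
    rw [hr, ENNReal.ofReal_le_one] at hs
    rw [hr, ENNReal.ofReal_rpow_of_nonneg hr0 hδ.le, Measure.smul_apply, smul_eq_mul,
      mul_comm, ← div_eq_mul_inv]
    refine ENNReal.div_le_of_le_mul' ?_
    rw [hc, ← ENNReal.ofReal_mul hc0.le]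
    have hb1 : (b : ℝ)⁻¹ < 1 := inv_lt_one_of_one_lt₀ (by linarith)
    rcases hr0.eq_or_lt with rfl | hr0
    · have hlim : Tendsto (fun m : ℕ => ENNReal.ofReal (25 * ((b : ℝ) ^ m)⁻¹ ^ δ)) atTop
          (𝓝 (ENNReal.ofReal (25 * 0 ^ δ))) := by
        refine ENNReal.tendsto_ofReal (Tendsto.const_mul _ ?_)
        refine Tendsto.rpow_const ?_ (Or.inr hδ.le)
        simp only [← inv_pow]
        exact tendsto_pow_atTop_nhds_zero_of_lt_one (by positivity) hb1
      rw [Real.zero_rpow hδ.ne', mul_zero] at hlim ⊢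
      exact ge_of_tendsto' hlim fun m => hball s m (by rw [hr]; simp)
    · obtain ⟨m, hm1, hm2⟩ := exists_nat_pow_near_of_lt_one hr0 hs (y := (b : ℝ)⁻¹)
        (by positivity) hb1
      refine (hball s m (by rw [hr, ← inv_pow]; gcongr)).trans (ENNReal.ofReal_le_ofReal ?_)
      rw [mul_assoc, ← Real.mul_rpow (by positivity) hr0.le]
      have : ((b : ℝ) ^ m)⁻¹ ≤ b * r := by
        rw [← inv_pow]
        rw [pow_succ, ← div_eq_mul_inv, div_lt_iff₀ (by positivity)] at hm1
        linarith
      gcongr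
  intro h0
  have h1 : c⁻¹ * μ E ≤ 0 := h0 ▸ hle E
  have h2 : 1 ≤ μ E := by
    refine le_trans ?_ (Measure.le_map_apply hπ.aemeasurable E)
    rw [show (fun σ : (i : ℕ) → A i => point b (digitSeq σ)) ⁻¹' E = univ from
      eq_univ_of_forall fun σ => hE _ fun i => (σ i).2, measure_univ]
  have h3 : c⁻¹ ≠ 0 := ENNReal.inv_ne_zero.2 ENNReal.ofReal_ne_top
  rw [nonpos_iff_eq_zero, mul_eq_zero] at h1
  rcases h1 with h1 | h1
  · exact h3 h1
  · rw [h1] at h2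
    exact absurd h2 (by simp)

/-! ### Alphabets forcing an orbit into the targets -/

/-- The alphabet at position `j` of a block: the digit of `ω` up to position `L`, the row of the
digit of `ω` up to position `M`, and then the digits `e₁` and `e₂`. -/
def blockAlphabet (J : Finset (ℕ × ℕ)) (ω : ℕ → ℕ × ℕ) (e₁ e₂ : ℕ × ℕ) (L M j : ℕ) :
    Finset (ℕ × ℕ) :=
  if j ≤ L then {ω j} else if j ≤ M then J2 J (ω j).2 else if j = M + 1 then {e₁} else {e₂}

theorem sum_log_card_blockAlphabet (J : Finset (ℕ × ℕ)) (ω : ℕ → ℕ × ℕ) (e₁ e₂ : ℕ × ℕ)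
    {L M : ℕ} (hLM : L ≤ M) (j : ℕ) :
    ∑ i ∈ Finset.range j, Real.log (blockAlphabet J ω e₁ e₂ L M (i + 1)).card =
      rowSum J ω (min j M) - rowSum J ω (min j L) := by
  induction j with
  | zero => simp
  | succ j ih =>
    rw [Finset.sum_range_succ, ih]
    unfold blockAlphabet
    rcases lt_or_ge j L with h1 | h1
    · rw [if_pos (by lia), min_eq_left (by lia), min_eq_left (by lia), min_eq_left (by lia),
        min_eq_left (by lia)]
      simp
    rcases lt_or_ge j M with h2 | h2
    · rw [if_neg (by lia), if_pos (by lia), min_eq_left (by lia), min_eq_right (by lia),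
        min_eq_left (by lia), min_eq_right (by lia)]
      simp only [rowSum, Finset.sum_range_succ]
      ring
    · rw [if_neg (by lia), if_neg (by lia), min_eq_right (by lia), min_eq_right (by lia),
        min_eq_right (by lia), min_eq_right (by lia)]
      split_ifs <;> simp

theorem blockAlphabet_subset {J : Finset (ℕ × ℕ)} {ω : ℕ → ℕ × ℕ} (hω : ∀ i, 1 ≤ i → ω i ∈ J)
    {e₁ e₂ : ℕ × ℕ} (he₁ : e₁ ∈ J) (he₂ : e₂ ∈ J) (L M : ℕ) {j : ℕ} (hj : 1 ≤ j) :
    blockAlphabet J ω e₁ e₂ L M j ⊆ J := by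
  unfold blockAlphabet
  split_ifs
  · simpa using hω j hj
  · exact Finset.filter_subset _ _
  · simpa using he₁
  · simpa using he₂

theorem blockAlphabet_nonempty {J : Finset (ℕ × ℕ)} {ω : ℕ → ℕ × ℕ}
    (hω : ∀ i, 1 ≤ i → ω i ∈ J) (e₁ e₂ : ℕ × ℕ) (L M : ℕ) {j : ℕ} (hj : 1 ≤ j) :
    (blockAlphabet J ω e₁ e₂ L M j).Nonempty := by
  unfold blockAlphabet
  split_ifs
  · simp
  · exact ⟨ω j, Finset.mem_filter.2 ⟨hω j hj, rfl⟩⟩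
  · simp
  · simp

open Classical in
/-- Alphabets which are full except in the blocks starting right after the positions `ν k`. -/
def targetAlphabet (J : Finset (ℕ × ℕ)) (ω : ℕ → ℕ × ℕ) (e₁ e₂ : ℕ × ℕ) (lam xi ν : ℕ → ℕ)
    (i : ℕ) : Finset (ℕ × ℕ) :=
  if h : ∃ k, ν k < i ∧ i ≤ ν k + xi (ν k) + 2 then
    blockAlphabet J ω e₁ e₂ (lam (ν h.choose)) (xi (ν h.choose)) (i - ν h.choose)
  else J

section Construction

variable {J : Finset (ℕ × ℕ)} {ω : ℕ → ℕ × ℕ} {e₁ e₂ : ℕ × ℕ} {lam xi ν : ℕ → ℕ}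

theorem strictMono_of_block_lt (hν : ∀ k, ν k + xi (ν k) + 2 < ν (k + 1)) : StrictMono ν :=
  strictMono_nat_of_lt_succ fun k => by have := hν k; lia

theorem lt_of_block_lt (hν : ∀ k, ν k + xi (ν k) + 2 < ν (k + 1)) {k k' : ℕ} (h : k < k') :
    ν k + xi (ν k) + 2 < ν k' :=
  (hν k).trans_le ((strictMono_of_block_lt hν).monotone h)

theorem targetAlphabet_block (hν : ∀ k, ν k + xi (ν k) + 2 < ν (k + 1)) (k : ℕ) {j : ℕ}
    (hj : 1 ≤ j) (hj' : j ≤ xi (ν k) + 2) :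
    targetAlphabet J ω e₁ e₂ lam xi ν (ν k + j) =
      blockAlphabet J ω e₁ e₂ (lam (ν k)) (xi (ν k)) j := by
  have h : ∃ k', ν k' < ν k + j ∧ ν k + j ≤ ν k' + xi (ν k') + 2 := ⟨k, by lia, by lia⟩
  have hk : h.choose = k := by
    obtain ⟨h1, h2⟩ := h.choose_spec
    rcases lt_trichotomy h.choose k with h3 | h3 | h3
    · have := lt_of_block_lt hν h3; lia
    · exact h3
    · have := lt_of_block_lt hν h3; lia
  rw [targetAlphabet, dif_pos h, hk, Nat.add_sub_cancel_left]

theorem targetAlphabet_first (hν : ∀ k, ν k + xi (ν k) + 2 < ν (k + 1)) {i : ℕ} (hi : i ≤ ν 0) :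
    targetAlphabet J ω e₁ e₂ lam xi ν i = J := by
  refine dif_neg ?_
  rintro ⟨k, h1, -⟩
  have := (strictMono_of_block_lt hν).monotone (Nat.zero_le k)
  lia

theorem targetAlphabet_gap (hν : ∀ k, ν k + xi (ν k) + 2 < ν (k + 1)) (k : ℕ) {i : ℕ}
    (hi : ν k + xi (ν k) + 2 < i) (hi' : i ≤ ν (k + 1)) :
    targetAlphabet J ω e₁ e₂ lam xi ν i = J := by
  refine dif_neg ?_
  rintro ⟨k', h1, h2⟩
  have hmono := strictMono_of_block_lt hν
  rcases lt_trichotomy k' k with h3 | rfl | h3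
  · have := lt_of_block_lt hν h3; lia
  · lia
  · have := hmono.monotone (show k + 1 ≤ k' from h3); lia

theorem targetAlphabet_subset (hω : ∀ i, 1 ≤ i → ω i ∈ J) (he₁ : e₁ ∈ J) (he₂ : e₂ ∈ J)
    (i : ℕ) : targetAlphabet J ω e₁ e₂ lam xi ν i ⊆ J := by
  unfold targetAlphabet
  split_ifs with h
  · exact blockAlphabet_subset hω he₁ he₂ _ _ (by have := h.choose_spec; lia)
  · rfl

theorem targetAlphabet_nonempty (hω : ∀ i, 1 ≤ i → ω i ∈ J) (i : ℕ) :
    (targetAlphabet J ω e₁ e₂ lam xi ν i).Nonempty := by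
  unfold targetAlphabet
  split_ifs with h
  · exact blockAlphabet_nonempty hω e₁ e₂ _ _ (by have := h.choose_spec; lia)
  · exact ⟨_, hω 1 le_rfl⟩

/-- The logarithm of the number of words of length `m` over the first `m` alphabets. -/
def logCount (A : ℕ → Finset (ℕ × ℕ)) (m : ℕ) : ℝ :=
  ∑ i ∈ Finset.range m, Real.log (A (i + 1)).card

theorem logCount_nonneg (A : ℕ → Finset (ℕ × ℕ)) (m : ℕ) : 0 ≤ logCount A m :=
  Finset.sum_nonneg fun _ _ => Real.log_natCast_nonneg _

theorem logCount_add (A : ℕ → Finset (ℕ × ℕ)) (m j : ℕ) :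
    logCount A (m + j) = logCount A m +
      ∑ i ∈ Finset.range j, Real.log (A (m + (i + 1))).card := by
  simp only [logCount, Finset.sum_range_add, add_assoc]

theorem logCount_block (hle : ∀ n, lam n ≤ xi n) (hν : ∀ k, ν k + xi (ν k) + 2 < ν (k + 1))
    (k : ℕ) {j : ℕ} (hj : j ≤ xi (ν k) + 2) :
    logCount (targetAlphabet J ω e₁ e₂ lam xi ν) (ν k + j) =
      logCount (targetAlphabet J ω e₁ e₂ lam xi ν) (ν k) +
        (rowSum J ω (min j (xi (ν k))) - rowSum J ω (min j (lam (ν k)))) := by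
  rw [logCount_add, ← sum_log_card_blockAlphabet J ω e₁ e₂ (hle _) j]
  congr 1
  refine Finset.sum_congr rfl fun i hi => ?_
  rw [targetAlphabet_block hν k (by lia) (by have := Finset.mem_range.1 hi; lia)]

theorem logCount_first (hν : ∀ k, ν k + xi (ν k) + 2 < ν (k + 1)) {m : ℕ} (hm : m ≤ ν 0) :
    logCount (targetAlphabet J ω e₁ e₂ lam xi ν) m = m * Real.log J.card := by
  rw [logCount, Finset.sum_congr rfl fun _ hi => by
    rw [targetAlphabet_first hν (by have := Finset.mem_range.1 hi; lia)]]
  simp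

theorem logCount_gap (hν : ∀ k, ν k + xi (ν k) + 2 < ν (k + 1)) (k : ℕ) {j : ℕ}
    (hj : ν k + xi (ν k) + 2 + j ≤ ν (k + 1)) :
    logCount (targetAlphabet J ω e₁ e₂ lam xi ν) (ν k + xi (ν k) + 2 + j) =
      logCount (targetAlphabet J ω e₁ e₂ lam xi ν) (ν k + xi (ν k) + 2) +
        j * Real.log J.card := by
  rw [logCount_add, Finset.sum_congr rfl fun _ hi => by
    rw [targetAlphabet_gap hν k (by lia) (by have := Finset.mem_range.1 hi; lia)]]
  simp

theorem mul_le_logCount (hle : ∀ n, lam n ≤ xi n)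
    (hν : ∀ k, ν k + xi (ν k) + 2 < ν (k + 1)) {c ε : ℝ} (hε : 0 < ε)
    (hc : c ≤ Real.log J.card)
    (hgrow : ∀ k, ((ν k + xi (ν k) + 2 : ℕ) : ℝ) * Real.log J.card ≤ ε * ν (k + 1))
    (hblock : ∀ k j, j ≤ xi (ν k) + 2 → c * (ν k + j) ≤ ν k * (Real.log J.card - ε) +
      (rowSum J ω (min j (xi (ν k))) - rowSum J ω (min j (lam (ν k))))) (m : ℕ) :
    c * m ≤ logCount (targetAlphabet J ω e₁ e₂ lam xi ν) m := by
  set S := logCount (targetAlphabet J ω e₁ e₂ lam xi ν) with hS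
  set g := Real.log J.card
  have hstart : ∀ k, ν k * (g - ε) ≤ S (ν k) := by
    intro k
    cases k with
    | zero =>
      rw [hS, logCount_first hν le_rfl]
      gcongr
      linarith
    | succ k =>
      obtain ⟨j, hj⟩ := Nat.exists_eq_add_of_le (hν k).le
      have h1 := hgrow k
      have h2 : (ν (k + 1) : ℝ) = (ν k + xi (ν k) + 2 : ℕ) + j := by exact_mod_cast hj
      have h3 : S (ν (k + 1)) = S (ν k + xi (ν k) + 2) + j * g := by
        rw [hj]; exact logCount_gap hν k hj.ge
      have h4 : 0 ≤ S (ν k + xi (ν k) + 2) := logCount_nonneg _ _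
      have h5 : (ν (k + 1) : ℝ) * g = (ν k + xi (ν k) + 2 : ℕ) * g + j * g := by rw [h2, add_mul]
      linarith
  have hinside : ∀ k j, j ≤ xi (ν k) + 2 → c * (ν k + j : ℕ) ≤ S (ν k + j) := by
    intro k j hj
    rw [hS, logCount_block hle hν k hj]
    have h1 := hblock k j hj
    have h2 := hstart k
    push_cast
    linarith
  have key : ∀ k m, m ≤ ν k → c * m ≤ S m := by
    intro k
    induction k with
    | zero =>
      intro m hm
      rw [hS, logCount_first hν hm, mul_comm]
      gcongr
    | succ k ih =>
      intro m hm
      rcases le_total m (ν k) with h1 | h1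
      · exact ih m h1
      obtain ⟨j, rfl⟩ := Nat.exists_eq_add_of_le h1
      rcases le_total j (xi (ν k) + 2) with h2 | h2
      · exact hinside k j h2
      obtain ⟨i, rfl⟩ := Nat.exists_eq_add_of_le h2
      have h3 := hinside k _ le_rfl
      have h4 : S (ν k + (xi (ν k) + 2) + i) = S (ν k + (xi (ν k) + 2)) + i * g :=
        logCount_gap hν k (by lia)
      rw [← add_assoc, h4, Nat.cast_add]
      have : c * i ≤ i * g := by rw [mul_comm]; gcongr
      linarith
  exact key m m ((strictMono_of_block_lt hν).id_le m)

theorem digit_eq_of_mem_targetAlphabet (hle : ∀ n, lam n ≤ xi n)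
    (hν : ∀ k, ν k + xi (ν k) + 2 < ν (k + 1)) {d : ℕ → ℕ × ℕ}
    (hd : ∀ i, d i ∈ targetAlphabet J ω e₁ e₂ lam xi ν i) (k : ℕ) {j : ℕ} (hj : 1 ≤ j)
    (hj' : j ≤ lam (ν k)) : d (ν k + j) = ω j := by
  have h := hd (ν k + j)
  rw [targetAlphabet_block hν k hj (by have := hle (ν k); lia), blockAlphabet,
    if_pos hj'] at h
  simpa using h

theorem snd_digit_eq_of_mem_targetAlphabet (hν : ∀ k, ν k + xi (ν k) + 2 < ν (k + 1))
    {d : ℕ → ℕ × ℕ} (hd : ∀ i, d i ∈ targetAlphabet J ω e₁ e₂ lam xi ν i) (k : ℕ) {j : ℕ}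
    (hj : 1 ≤ j) (hj' : j ≤ xi (ν k)) : (d (ν k + j)).2 = (ω j).2 := by
  have h := hd (ν k + j)
  rw [targetAlphabet_block hν k hj (by lia), blockAlphabet] at h
  split_ifs at h
  · rw [Finset.mem_singleton.1 h]
  · exact (Finset.mem_filter.1 h).2

theorem last_digits_eq_of_mem_targetAlphabet (hle : ∀ n, lam n ≤ xi n)
    (hν : ∀ k, ν k + xi (ν k) + 2 < ν (k + 1)) {d : ℕ → ℕ × ℕ}
    (hd : ∀ i, d i ∈ targetAlphabet J ω e₁ e₂ lam xi ν i) (k : ℕ) :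
    d (ν k + (xi (ν k) + 1)) = e₁ ∧ d (ν k + (xi (ν k) + 2)) = e₂ := by
  have h1 := hd (ν k + (xi (ν k) + 1))
  have h2 := hd (ν k + (xi (ν k) + 2))
  have h3 := hle (ν k)
  rw [targetAlphabet_block hν k (by lia) (by lia), blockAlphabet, if_neg (by lia),
    if_neg (by lia), if_pos rfl] at h1
  rw [targetAlphabet_block hν k (by lia) (by lia), blockAlphabet, if_neg (by lia),
    if_neg (by lia), if_neg (by lia)] at h2
  exact ⟨by simpa using h1, by simpa using h2⟩

theorem isGeneric_of_mem_targetAlphabet (hle : ∀ n, lam n ≤ xi n)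
    (hxi_top : Tendsto xi atTop atTop) (hν : ∀ k, ν k + xi (ν k) + 2 < ν (k + 1))
    (hω : ∀ i, 1 ≤ i → ω i ∈ J) (he₁ : e₁ ∈ J) (he₂ : e₂ ∈ J)
    (he : (∀ a ∈ J, ∀ a' ∈ J, a.1 = a'.1) ∨ e₁.1 ≠ e₂.1)
    (h0 : ∃ i, 1 ≤ i ∧ (ω i).2 ≠ 0) (h1 : ∃ i, 1 ≤ i ∧ (ω i).2 ≠ b - 1) {d : ℕ → ℕ × ℕ}
    (hd : ∀ i, d i ∈ targetAlphabet J ω e₁ e₂ lam xi ν i) : IsGeneric b J d := by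
  have hmono := strictMono_of_block_lt hν
  have hfst : e₁.1 ≠ e₂.1 → ∀ a N, ∃ i, N < i ∧ (d i).1 ≠ a := by
    intro hne a N
    have hN := hmono.id_le N
    simp only [id] at hN
    obtain ⟨h1, h2⟩ := last_digits_eq_of_mem_targetAlphabet hle hν hd N
    by_cases h : e₁.1 = a
    · exact ⟨ν N + (xi (ν N) + 2), by lia, by rw [h2]; exact fun h' => hne (h.trans h'.symm)⟩
    · exact ⟨ν N + (xi (ν N) + 1), by lia, by rwa [h1]⟩
  have hsnd : ∀ a, (∃ i, 1 ≤ i ∧ (ω i).2 ≠ a) → ∀ N, ∃ i, N < i ∧ (d i).2 ≠ a := by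
    rintro a ⟨j, hj, hja⟩ N
    obtain ⟨k, hk, hkN⟩ := (((hxi_top.comp hmono.tendsto_atTop).eventually_ge_atTop j).and
      (hmono.tendsto_atTop.eventually_ge_atTop N)).exists
    refine ⟨ν k + j, by lia, ?_⟩
    rwa [snd_digit_eq_of_mem_targetAlphabet hν hd k hj hk]
  exact
    { mem := fun i _ => targetAlphabet_subset hω he₁ he₂ i (hd i)
      fst := he.imp_right fun h => ⟨hfst h _, hfst h _⟩
      snd_ne_zero := hsnd _ h0
      snd_ne_pred := hsnd _ h1 }

theorem point_mem_targetSet (hb : 2 ≤ b) (hJ : J ⊆ Finset.range b ×ˢ Finset.range b)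
    (R : RepMap b J) (hle : ∀ n, lam n ≤ xi n) (hν : ∀ k, ν k + xi (ν k) + 2 < ν (k + 1))
    (hω : ∀ i, 1 ≤ i → ω i ∈ J) {z w : ℝ} (hzw : point b ω = (z, w)) {d : ℕ → ℕ × ℕ}
    (hd : ∀ i, d i ∈ targetAlphabet J ω e₁ e₂ lam xi ν i) (hgen : IsGeneric b J d) :
    point b d ∈ targetSet R lam xi z w := by
  have hmono := strictMono_of_block_lt hν
  refine ⟨point_mem_carpet hgen.mem, frequently_atTop.2 fun k => ⟨ν k, hmono.id_le k, ?_⟩⟩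
  rw [hgen.Tmap_iterate hb hJ R]
  obtain ⟨rfl, rfl⟩ := Prod.mk.inj hzw
  have hfst := abs_val_sub_val_le hb (u := fun i => (d (i + ν k)).1) (v := fun i => (ω i).1)
    (m := lam (ν k)) (fun i hi => fst_lt_of_mem hJ (hgen.mem _ (by lia)))
    (fun i hi => fst_lt_of_mem hJ (hω i hi)) fun i h1 h2 => by
      rw [add_comm, digit_eq_of_mem_targetAlphabet hle hν hd k h1 h2]
  have hsnd := abs_val_sub_val_le hb (u := fun i => (d (i + ν k)).2) (v := fun i => (ω i).2)
    (m := xi (ν k)) (fun i hi => snd_lt_of_mem hJ (hgen.mem _ (by lia)))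
    (fun i hi => snd_lt_of_mem hJ (hω i hi)) fun i h1 h2 => by
      rw [add_comm, snd_digit_eq_of_mem_targetAlphabet hν hd k h1 h2]
  rw [abs_le] at hfst hsnd
  simp only [zpow_neg, zpow_natCast, point]
  exact ⟨⟨by linarith [hfst.1], by linarith [hfst.2]⟩,
    ⟨by linarith [hsnd.1], by linarith [hsnd.2]⟩⟩

end Construction

/-! ### The lower bound -/

theorem exists_abs_sub_mul_le {F : ℕ → ℝ} {h : ℝ}
    (hF : Tendsto (fun m : ℕ => F m / m) atTop (𝓝 h)) {η : ℝ} (hη : 0 < η) :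
    ∃ C, ∀ m : ℕ, |F m - h * m| ≤ η * m + C := by
  have hev : ∀ᶠ m : ℕ in atTop, |F m - h * m| - η * m ≤ 0 := by
    filter_upwards [Metric.tendsto_nhds.1 hF η hη, eventually_gt_atTop 0] with m hm hm0
    have hm0' : (0 : ℝ) < m := by exact_mod_cast hm0
    have h1 : F m - h * m = (F m / m - h) * m := by field_simp
    rw [Real.dist_eq] at hm
    rw [h1, abs_mul, abs_of_pos hm0', sub_nonpos]
    gcongr
  obtain ⟨C, hC⟩ := (isBoundedUnder_of_eventually_le hev).bddAbove_range
  exact ⟨C, fun m => by linarith [hC (mem_range_self m)]⟩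

theorem eventually_mul_le_block {F : ℕ → ℝ} {lam xi : ℕ → ℕ} (hle : ∀ n, lam n ≤ xi n)
    {l x : ℝ} (hl : Tendsto (fun n : ℕ => (lam n : ℝ) / n) atTop (𝓝 l))
    (hx : Tendsto (fun n : ℕ => (xi n : ℝ) / n) atTop (𝓝 x)) (hx0 : 0 < x) {h : ℝ}
    (hF : Tendsto (fun m : ℕ => F m / m) atTop (𝓝 h)) {c g : ℝ} (hc : 0 < c)
    (h1 : c * (1 + l) < g) (h2 : c * (1 + x) < g + (x - l) * h) :
    ∃ ε > 0, ∀ᶠ n in atTop, ∀ j, j ≤ xi n + 2 →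
      c * (n + j) ≤ n * (g - ε) + (F (min j (xi n)) - F (min j (lam n))) := by
  obtain ⟨ε, hε, hε1, hε2⟩ : ∃ ε > 0, c * (1 + l) + 3 * ε < g ∧
      c * (1 + x) + 3 * ε < g + (x - l) * h := by
    obtain ⟨κ, hκ, hκ'⟩ := exists_between
      (lt_min (sub_pos.2 h1) (sub_pos.2 h2))
    rw [lt_min_iff] at hκ'
    exact ⟨κ / 3, by linarith, by linarith [hκ'.1], by linarith [hκ'.2]⟩
  refine ⟨ε, hε, ?_⟩
  set η := ε / (2 * x) with hη
  have hη0 : 0 < η := by positivity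
  have hηx : 2 * η * x = ε := by rw [hη]; field_simp
  obtain ⟨C, hC⟩ := exists_abs_sub_mul_le hF hη0
  have h0 := tendsto_one_div_atTop_nhds_zero_nat (𝕜 := ℝ)
  have hlim1 : Tendsto (fun n : ℕ => (g - ε) - 2 * η * ((xi n : ℝ) / n) - 2 * C * (1 / n) -
      c * (1 + (lam n : ℝ) / n)) atTop (𝓝 ((g - ε) - 2 * η * x - 2 * C * 0 - c * (1 + l))) :=
    ((tendsto_const_nhds.sub (hx.const_mul _)).sub (h0.const_mul _)).sub
      ((hl.const_add 1).const_mul c)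
  have hlim2 : Tendsto (fun n : ℕ => (g - ε) + h * ((xi n : ℝ) / n - (lam n : ℝ) / n) -
      2 * η * ((xi n : ℝ) / n) - 2 * C * (1 / n) - c * (1 + (xi n : ℝ) / n) - 2 * c * (1 / n))
      atTop (𝓝 ((g - ε) + h * (x - l) - 2 * η * x - 2 * C * 0 - c * (1 + x) - 2 * c * 0)) :=
    ((((tendsto_const_nhds.add ((hx.sub hl).const_mul h)).sub (hx.const_mul _)).sub
      (h0.const_mul _)).sub ((hx.const_add 1).const_mul c)).sub (h0.const_mul _)
  filter_upwards [hlim1.eventually_const_lt (u := 0) (by linarith),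
    hlim2.eventually_const_lt (u := 0) (by linarith), eventually_gt_atTop 0] with n hn1 hn2 hn0
  have hn0' : (0 : ℝ) < n := by exact_mod_cast hn0
  have hlx : (lam n : ℝ) ≤ xi n := by exact_mod_cast hle n
  have e1 : 0 < n * (g - ε) - 2 * η * xi n - 2 * C - c * (n + lam n) := by
    have := mul_pos hn0' hn1
    field_simp at this
    linarith
  have e2 : 0 < n * (g - ε) + h * (xi n - lam n) - 2 * η * xi n - 2 * C - c * (n + xi n) -
      2 * c := by
    have := mul_pos hn0' hn2
    field_simp at this
    linarith
  have hbound : ∀ m : ℕ, m ≤ xi n → |F m - h * m| ≤ η * xi n + C := by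
    intro m hm
    have : η * (m : ℝ) ≤ η * xi n := by gcongr
    linarith [hC m]
  intro j hj
  have hA := abs_le.1 (hbound (min j (xi n)) (min_le_right _ _))
  have hB := abs_le.1 (hbound (min j (lam n)) ((min_le_right _ _).trans (hle n)))
  rcases le_total j (lam n) with hjl | hjl
  · have : (j : ℝ) ≤ lam n := by exact_mod_cast hjl
    rw [min_eq_left hjl, min_eq_left (hjl.trans (hle n))] at *
    nlinarith
  rcases le_total j (xi n) with hjx | hjx
  · rw [min_eq_left hjx, min_eq_right hjl] at *
    have h3 : (lam n : ℝ) ≤ j := by exact_mod_cast hjl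
    have h4 : (j : ℝ) ≤ xi n := by exact_mod_cast hjx
    rcases le_total c h with hch | hch
    · nlinarith [mul_nonneg (sub_nonneg.2 hch) (sub_nonneg.2 h3)]
    · nlinarith [mul_nonneg (sub_nonneg.2 hch) (sub_nonneg.2 h4)]
  · rw [min_eq_right hjx, min_eq_right hjl] at *
    have h4 : (j : ℝ) ≤ xi n + 2 := by exact_mod_cast hj
    nlinarith

theorem exists_sparse_sequence (xi : ℕ → ℕ) (N₀ : ℕ) (g : ℝ) {ε : ℝ} (hε : 0 < ε) :
    ∃ ν : ℕ → ℕ, (∀ k, N₀ ≤ ν k) ∧ (∀ k, ν k + xi (ν k) + 2 < ν (k + 1)) ∧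
      ∀ k, ((ν k + xi (ν k) + 2 : ℕ) : ℝ) * g ≤ ε * ν (k + 1) := by
  let next : ℕ → ℕ := fun n => (n + xi n + 2) * (⌈g / ε⌉₊ + 1) + 1
  let ν : ℕ → ℕ := fun k => next^[k] N₀
  have hsucc : ∀ k, ν (k + 1) = (ν k + xi (ν k) + 2) * (⌈g / ε⌉₊ + 1) + 1 := fun k =>
    Function.iterate_succ_apply' next k N₀
  have hlt : ∀ k, ν k + xi (ν k) + 2 < ν (k + 1) := fun k => by
    rw [hsucc, Nat.lt_succ_iff]
    exact Nat.le_mul_of_pos_right _ (by lia)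
  refine ⟨ν, fun k => (strictMono_of_block_lt hlt).monotone (Nat.zero_le k), hlt, fun k => ?_⟩
  have h1 : g ≤ ε * ⌈g / ε⌉₊ := by
    rw [mul_comm, ← div_le_iff₀ hε]
    exact Nat.le_ceil _
  rw [hsucc]
  push_cast
  have h2 : (0 : ℝ) ≤ ν k + xi (ν k) + 2 := by positivity
  nlinarith [mul_le_mul_of_nonneg_left h1 h2, mul_nonneg hε.le h2]

theorem exists_digit_ne {u : ℕ → ℕ} {a : ℕ} {q : ℝ} (hq : q < 1)
    (hu : Tendsto (fun n : ℕ => (freqCount u a n : ℝ) / n) atTop (𝓝 q)) :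
    ∃ i, 1 ≤ i ∧ u i ≠ a := by
  by_contra! hcon
  refine absurd (tendsto_nhds_unique hu (tendsto_const_nhds.congr' (f₁ := fun _ => (1 : ℝ)) ?_))
    hq.ne
  filter_upwards [eventually_gt_atTop 0] with n hn
  have hn0 : (n : ℝ) ≠ 0 := by exact_mod_cast hn.ne'
  rw [freqCount_eq_add (Nat.zero_le n) fun i hi _ => hcon i hi]
  simp [freqCount, hn0]

theorem hausdorffMeasure_targetSet_ne_zero {J : Finset (ℕ × ℕ)} (hb : 2 ≤ b)
    (hJ : J ⊆ Finset.range b ×ˢ Finset.range b) (R : RepMap b J) {lam xi : ℕ → ℕ}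
    (hle : ∀ n, lam n ≤ xi n) (hlam_top : Tendsto lam atTop atTop) {ω : ℕ → ℕ × ℕ}
    (hω : ∀ i, 1 ≤ i → ω i ∈ J) {z w : ℝ} (hzw : point b ω = (z, w)) {l x : ℝ} (hl0 : 0 ≤ l)
    (hlx : l < x) (hl : Tendsto (fun n : ℕ => (lam n : ℝ) / n) atTop (𝓝 l))
    (hx : Tendsto (fun n : ℕ => (xi n : ℝ) / n) atTop (𝓝 x))
    (h0 : ∃ i, 1 ≤ i ∧ (ω i).2 ≠ 0) (h1 : ∃ i, 1 ≤ i ∧ (ω i).2 ≠ b - 1)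
    {h : ℝ} (hrow : Tendsto (fun m : ℕ => rowSum J ω m / m) atTop (𝓝 h)) {s : ℝ} (hs : 0 < s)
    (hs1 : s < (Real.log J.card / Real.log b) / (1 + l))
    (hs2 : s < (Real.log J.card / Real.log b + (x - l) * (h / Real.log b)) / (1 + x)) :
    μH[s] (targetSet R lam xi z w) ≠ 0 := by
  have hlogb : 0 < Real.log b := Real.log_pos (by exact_mod_cast (by lia : 1 < b))
  rw [lt_div_iff₀ (by linarith), lt_div_iff₀ hlogb] at hs1
  rw [lt_div_iff₀ (by linarith), ← mul_div_assoc, ← add_div, lt_div_iff₀ hlogb] at hs2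
  have hc : 0 < s * Real.log b := mul_pos hs hlogb
  obtain ⟨e₁, he₁, e₂, he₂, he⟩ : ∃ e₁ ∈ J, ∃ e₂ ∈ J,
      (∀ a ∈ J, ∀ a' ∈ J, a.1 = a'.1) ∨ e₁.1 ≠ e₂.1 := by
    by_cases hcol : ∀ a ∈ J, ∀ a' ∈ J, a.1 = a'.1
    · exact ⟨_, hω 1 le_rfl, _, hω 1 le_rfl, Or.inl hcol⟩
    · push Not at hcol
      obtain ⟨e₁, he₁, e₂, he₂, he⟩ := hcol
      exact ⟨e₁, he₁, e₂, he₂, Or.inr he⟩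
  obtain ⟨ε, hε, hev⟩ := eventually_mul_le_block hle hl hx (by linarith) hrow hc
    (g := Real.log J.card) (by linarith) (by linarith)
  obtain ⟨N₀, hN₀⟩ := eventually_atTop.1 hev
  obtain ⟨ν, hν0, hν, hgrow⟩ := exists_sparse_sequence xi N₀ (Real.log J.card) hε
  refine hausdorffMeasure_ne_zero_of_alphabets hb hJ
    (A := targetAlphabet J ω e₁ e₂ lam xi ν) (targetAlphabet_nonempty hω)
    (targetAlphabet_subset hω he₁ he₂) hs ?_ fun d hd => ?_
  · exact mul_le_logCount hle hν hε (by nlinarith) hgrow fun k => hN₀ _ (hν0 k)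
  · exact point_mem_targetSet hb hJ R hle hν hω hzw hd (isGeneric_of_mem_targetAlphabet hle
      (tendsto_atTop_mono hle hlam_top) hν hω he₁ he₂ he h0 h1 hd)

end Auxiliary

theorem stmt_3
    (b : ℕ) (J : Finset (ℕ × ℕ)) (hb : 2 ≤ b)
    (hJ : J ⊂ Finset.range b ×ˢ Finset.range b) (hJcard : 2 ≤ J.card)
    (R : RepMap b J) (lam xi : ℕ → ℕ)
    (hlam_pos : ∀ n, 1 ≤ lam n) (hle : ∀ n, lam n ≤ xi n)
    (hlam_top : Tendsto lam atTop atTop)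
    (z w : ℝ) (hzw : (z, w) ∈ carpet b J)
    (l x : ℝ)
    (hl : Tendsto (fun n : ℕ => (lam n : ℝ) / n) atTop (𝓝 l))
    (hx : Tendsto (fun n : ℕ => (xi n : ℝ) / n) atTop (𝓝 x))
    (hlx : l < x)
    (p : ℕ → ℝ)
    (hp : ∀ a, a < b →
      Tendsto (fun n : ℕ => (freqCount (wdig R (z, w)) a n : ℝ) / n) atTop (𝓝 (p a)))
    (hp0 : p 0 < 1) (hpb : p (b - 1) < 1) :
    dimH (targetSet R lam xi z w) =
      ENNReal.ofReal (min ((Real.log J.card / Real.log b) / (1 + l))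
        (((Real.log J.card / Real.log b) +
            (x - l) * ((∑ a ∈ Finset.range b, p a * Real.log ((J2 J a).card)) / Real.log b)) /
          (1 + x))) := by
  have hJ' := hJ.1
  have hω : ∀ i, 1 ≤ i → R.rep (z, w) i ∈ J := R.mem_J _ hzw
  have hpt : point b (R.rep (z, w)) = (z, w) := point_rep R hzw
  have hl0 : 0 ≤ l := ge_of_tendsto' hl fun n => by positivity
  have hp0' := hp 0 (by lia)
  have hpb' := hp (b - 1) (by lia)
  have hrow := tendsto_rowSum_div (J := J) (fun i hi => snd_lt_of_mem hJ' (hω i hi)) hp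
  apply le_antisymm
  · by_contra! hlt
    obtain ⟨s, hs1, hs2⟩ := ENNReal.lt_iff_exists_nnreal_btwn.1 hlt
    have hzero : μH[s] (targetSet R lam xi z w) = 0 := by
      rw [← ENNReal.ofReal_coe_nnreal, ENNReal.ofReal_lt_ofReal_iff', min_lt_iff] at hs1
      rcases hs1.1 with hs | hs
      · exact hausdorffMeasure_targetSet_eq_zero_of_div_lt hb hJ' R hle hω hpt hl0 hl s.2 hs
      · exact hausdorffMeasure_targetSet_eq_zero_of_add_div_lt hb hJ' R hle hlam_top hω hpt hl0
          hlx hl hx hp0 hpb hp0' hpb' hrow s.2 hs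
    rw [hausdorffMeasure_of_lt_dimH hs2] at hzero
    exact ENNReal.top_ne_zero hzero
  · by_contra! hlt
    obtain ⟨s, hs1, hs2⟩ := ENNReal.lt_iff_exists_nnreal_btwn.1 hlt
    rw [← ENNReal.ofReal_coe_nnreal, ENNReal.ofReal_lt_ofReal_iff', lt_min_iff] at hs2
    exact hausdorffMeasure_targetSet_ne_zero hb hJ' R hle hlam_top hω hpt hl0 hlx hl hx
      (exists_digit_ne hp0 hp0') (exists_digit_ne hpb hpb') hrow
      (NNReal.coe_pos.2 (ENNReal.coe_pos.1 (pos_of_gt hs1))) hs2.1.1 hs2.1.2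
      (hausdorffMeasure_of_dimH_lt hs1)

end ShrinkingRect
end
end

section
/- Let (w_i)_{i∈ℕ} be a sequence of digits in {0,…,b−1} with J₂(w_i) ≠ ∅ for all i, and suppose the real number w = Σ_{i≥1} w_i b^{−i} has a unique base-b expansion. Define the horizontal slice Λ^w = {Σ_{i≥1} x_i b^{−i} : (x_i,w_i) ∈ J for all i ∈ ℕ}. Then dim_H Λ^w = liminf_{n→∞} (Σ_{a=0}^{b−1} #{1 ≤ i ≤ n : w_i = a}·log #J₂(a)) / (n log b). In particular, if for each a ∈ {0,…,b−1} the limit p_a := lim_{n→∞} #{1 ≤ i ≤ n : w_i = a}/n exists, then dim_H Λ^w = (Σ_{a=0}^{b−1} p_a log #J₂(a)) / log b. -/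
open Set Filter Topology MeasureTheory
open scoped ENNReal NNReal Topology

noncomputable section

namespace ShrinkingRect

/-- The integer with base-`b` digits `x 0, …, x (n - 1)`, most significant digit first. -/
def leadingDigits {b : ℕ} (x : ℕ → Fin b) : ℕ → ℕ
  | 0 => 0
  | n + 1 => b * leadingDigits x n + x n

theorem eq_of_leadingDigits_eq {b : ℕ} {x y : ℕ → Fin b} {n : ℕ}
    (h : leadingDigits x n = leadingDigits y n) : ∀ i < n, x i = y i := by
  induction n with
  | zero => simp
  | succ n ih =>
    have hb : 0 < b := Fin.pos (x 0)
    simp only [leadingDigits] at h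
    have hdiv := congrArg (· / b) h
    have hmod := congrArg (· % b) h
    simp only [Nat.mul_add_div hb, Nat.div_eq_of_lt (x n).isLt, Nat.div_eq_of_lt (y n).isLt,
      Nat.mul_add_mod, Nat.mod_eq_of_lt (x n).isLt, Nat.mod_eq_of_lt (y n).isLt,
      add_zero] at hdiv hmod
    intro i hi
    rcases Nat.lt_succ_iff_lt_or_eq.mp hi with hi | rfl
    · exact ih hdiv i hi
    · exact Fin.ext hmod

theorem pow_mul_sum_ofDigitsTerm {b : ℕ} (x : ℕ → Fin b) (n : ℕ) :
    (b : ℝ) ^ n * ∑ i ∈ Finset.range n, Real.ofDigitsTerm x i = leadingDigits x n := by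
  have hb : (b : ℝ) ≠ 0 := by exact_mod_cast (Fin.pos (x 0)).ne'
  induction n with
  | zero => simp [leadingDigits]
  | succ n ih =>
    rw [Finset.sum_range_succ, mul_add, pow_succ', mul_assoc, ih, leadingDigits, Real.ofDigitsTerm]
    push_cast
    field_simp
    ring

theorem pow_mul_ofDigits_mem_Icc {b : ℕ} (x : ℕ → Fin b) (n : ℕ) :
    (b : ℝ) ^ n * Real.ofDigits x ∈ Icc (leadingDigits x n : ℝ) (leadingDigits x n + 1) := by
  have hb : (b : ℝ) ≠ 0 := by exact_mod_cast (Fin.pos (x 0)).ne'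
  rw [Real.ofDigits_eq_sum_add_ofDigits x n, mul_add, pow_mul_sum_ofDigitsTerm,
    mul_inv_cancel_left₀ (pow_ne_zero n hb)]
  exact ⟨by linarith [Real.ofDigits_nonneg fun i => x (i + n)],
    by linarith [Real.ofDigits_le_one fun i => x (i + n)]⟩

/-- Points at distance at most `b⁻ⁿ` have nearby digit prefixes of length `n`. -/
theorem leadingDigits_mem_Icc {b : ℕ} {x y : ℕ → Fin b} {n : ℕ}
    (h : |Real.ofDigits x - Real.ofDigits y| ≤ ((b : ℝ) ^ n)⁻¹) :
    leadingDigits x n ∈ Finset.Icc (leadingDigits y n - 2) (leadingDigits y n + 2) := by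
  have hb : (0 : ℝ) < (b : ℝ) ^ n := pow_pos (by exact_mod_cast Fin.pos (x 0)) n
  have hx := pow_mul_ofDigits_mem_Icc x n
  have hy := pow_mul_ofDigits_mem_Icc y n
  have h' : |(b : ℝ) ^ n * Real.ofDigits x - (b : ℝ) ^ n * Real.ofDigits y| ≤ 1 := by
    rw [← mul_sub, abs_mul, abs_of_pos hb]
    calc (b : ℝ) ^ n * |Real.ofDigits x - Real.ofDigits y| ≤ (b : ℝ) ^ n * ((b : ℝ) ^ n)⁻¹ := by
          gcongr
      _ = 1 := mul_inv_cancel₀ hb.ne'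
  rw [abs_le] at h'
  have h1 : (leadingDigits x n : ℝ) ≤ leadingDigits y n + 2 := by linarith [hx.1, hy.2, h'.2]
  have h2 : (leadingDigits y n : ℝ) ≤ leadingDigits x n + 2 := by linarith [hx.2, hy.1, h'.1]
  have h1' : leadingDigits x n ≤ leadingDigits y n + 2 := by exact_mod_cast h1
  have h2' : leadingDigits y n ≤ leadingDigits x n + 2 := by exact_mod_cast h2
  rw [Finset.mem_Icc]
  omega

/-- The set of reals having a base-`b` expansion whose `i`-th digit lies in `D i` for all `i`. -/
def digitSet {b : ℕ} (D : ℕ → Finset (Fin b)) : Set ℝ :=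
  Real.ofDigits '' Set.univ.pi fun i => (D i : Set (Fin b))

/-- The product of the uniform measures on the digit sets `D i`. -/
def digitMeasure {b : ℕ} (D : ℕ → Finset (Fin b)) : Measure (ℕ → Fin b) :=
  Measure.infinitePi fun i => ProbabilityTheory.uniformOn (D i : Set (Fin b))

theorem isProbabilityMeasure_uniformOn_digits {b : ℕ} {D : ℕ → Finset (Fin b)}
    (hD : ∀ i, (D i).Nonempty) (i : ℕ) :
    IsProbabilityMeasure (ProbabilityTheory.uniformOn (D i : Set (Fin b))) :=
  ProbabilityTheory.isProbabilityMeasure_uniformOn (D i).finite_toSet (hD i)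

theorem digitMeasure_leadingDigits_eq_le {b : ℕ} {D : ℕ → Finset (Fin b)}
    (hD : ∀ i, (D i).Nonempty) (n k : ℕ) :
    digitMeasure D {x | leadingDigits x n = k} ≤
      ((∏ i ∈ Finset.range n, (D i).card : ℕ) : ℝ≥0∞)⁻¹ := by
  have := isProbabilityMeasure_uniformOn_digits hD
  rcases Set.eq_empty_or_nonempty {x : ℕ → Fin b | leadingDigits x n = k} with h | ⟨x, hx⟩
  · simp [h]
  calc digitMeasure D {x | leadingDigits x n = k}
      ≤ digitMeasure D (Set.pi (Finset.range n : Set ℕ) fun i => {x i}) := by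
        refine measure_mono fun y hy => ?_
        intro i hi
        exact eq_of_leadingDigits_eq (hy.trans hx.symm) i (by simpa using hi)
    _ = ∏ i ∈ Finset.range n, ProbabilityTheory.uniformOn (D i : Set (Fin b)) {x i} :=
        Measure.infinitePi_pi _ fun i _ => measurableSet_singleton _
    _ ≤ ∏ i ∈ Finset.range n, ((D i).card : ℝ≥0∞)⁻¹ := by
        refine Finset.prod_le_prod' fun i _ => ?_
        rw [← Finset.coe_singleton, ProbabilityTheory.uniformOn_apply_finset, ENNReal.div_eq_inv_mul]
        refine mul_le_of_le_one_right' ?_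
        exact_mod_cast (Finset.card_le_card Finset.inter_subset_right).trans
          (Finset.card_singleton _).le
    _ = ((∏ i ∈ Finset.range n, (D i).card : ℕ) : ℝ≥0∞)⁻¹ := by
        rw [Nat.cast_prod, ENNReal.prod_inv_distrib]
        exact fun i _ j _ _ => Or.inr (ENNReal.natCast_ne_top _)

theorem digitMeasure_preimage_le {b : ℕ} {D : ℕ → Finset (Fin b)}
    (hD : ∀ i, (D i).Nonempty) {n : ℕ} {A : Set ℝ}
    (hA : ∀ x ∈ A, ∀ y ∈ A, |x - y| ≤ ((b : ℝ) ^ n)⁻¹) :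
    digitMeasure D (Real.ofDigits ⁻¹' A) ≤
      5 * ((∏ i ∈ Finset.range n, (D i).card : ℕ) : ℝ≥0∞)⁻¹ := by
  rcases Set.eq_empty_or_nonempty (Real.ofDigits ⁻¹' A : Set (ℕ → Fin b)) with h | ⟨y, hy⟩
  · simp [h]
  set I := Finset.Icc (leadingDigits y n - 2) (leadingDigits y n + 2) with hI
  calc digitMeasure D (Real.ofDigits ⁻¹' A)
      ≤ digitMeasure D (⋃ k ∈ I, {x | leadingDigits x n = k}) := by
        refine measure_mono fun x hx => ?_
        simp only [mem_iUnion, Set.mem_ofPred_eq, exists_prop, exists_eq_right']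
        exact leadingDigits_mem_Icc (hA _ hx _ hy)
    _ ≤ ∑ k ∈ I, digitMeasure D {x | leadingDigits x n = k} := measure_biUnion_finset_le _ _
    _ ≤ I.card • ((∏ i ∈ Finset.range n, (D i).card : ℕ) : ℝ≥0∞)⁻¹ :=
        Finset.sum_le_card_nsmul _ _ _ fun k _ => digitMeasure_leadingDigits_eq_le hD n k
    _ ≤ 5 * ((∏ i ∈ Finset.range n, (D i).card : ℕ) : ℝ≥0∞)⁻¹ := by
        rw [nsmul_eq_mul]
        gcongr
        have : I.card ≤ 5 := by rw [hI, Nat.card_Icc]; omega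
        exact_mod_cast this

theorem one_le_map_digitMeasure_digitSet {b : ℕ} {D : ℕ → Finset (Fin b)}
    (hD : ∀ i, (D i).Nonempty) :
    1 ≤ (digitMeasure D).map Real.ofDigits (digitSet D) := by
  have := isProbabilityMeasure_uniformOn_digits hD
  calc (1 : ℝ≥0∞) = digitMeasure D (Set.univ.pi fun i => (D i : Set (Fin b))) := by
        rw [digitMeasure, Measure.infinitePi_pi_univ _ fun i => (D i).measurableSet]
        simp [ProbabilityTheory.uniformOn_self (D _).finite_toSet (hD _)]
    _ ≤ digitMeasure D (Real.ofDigits ⁻¹' digitSet D) :=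
        measure_mono (subset_preimage_image _ _)
    _ ≤ (digitMeasure D).map Real.ofDigits (digitSet D) :=
        Measure.le_map_apply Real.continuous_ofDigits.measurable.aemeasurable _

/-- Mass distribution: if the number of prefixes of length `n` is eventually at least `b ^ (n s)`,
then the Hausdorff dimension is at least `s`. -/
theorem le_dimH_digitSet {b : ℕ} (hb : 2 ≤ b) {D : ℕ → Finset (Fin b)}
    (hD : ∀ i, (D i).Nonempty) {s : ℝ≥0} (hs : 0 < s) {N : ℕ}
    (hN : ∀ n, N ≤ n →
      (((b : ℝ)⁻¹ ^ n) ^ (s : ℝ))⁻¹ ≤ ((∏ i ∈ Finset.range n, (D i).card : ℕ) : ℝ)) :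
    (s : ℝ≥0∞) ≤ dimH (digitSet D) := by
  have hb0 : (0 : ℝ) < b := by positivity
  have hr0 : (0 : ℝ) < (b : ℝ)⁻¹ := by positivity
  have hr1 : (b : ℝ)⁻¹ < 1 := inv_lt_one_of_one_lt₀ (by exact_mod_cast hb)
  have hs' : (0 : ℝ) < s := hs
  set μ := (digitMeasure D).map (Real.ofDigits (b := b))
  have key (n : ℕ) (hn : N ≤ n) (A : Set ℝ) (hA : Metric.ediam A ≤ ENNReal.ofReal ((b : ℝ)⁻¹ ^ n)) :
      μ A ≤ ENNReal.ofReal (5 * ((b : ℝ)⁻¹ ^ n) ^ (s : ℝ)) := by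
    have hcl : ∀ x ∈ closure A, ∀ y ∈ closure A, |x - y| ≤ ((b : ℝ) ^ n)⁻¹ := by
      intro x hx y hy
      have := (Metric.edist_le_ediam_of_mem hx hy).trans ((Metric.ediam_closure A).le.trans hA)
      rwa [edist_dist, ENNReal.ofReal_le_ofReal_iff (by positivity), Real.dist_eq, inv_pow] at this
    calc μ A ≤ μ (closure A) := measure_mono subset_closure
      _ = digitMeasure D (Real.ofDigits ⁻¹' closure A) :=
        Measure.map_apply Real.continuous_ofDigits.measurable isClosed_closure.measurableSet
      _ ≤ 5 * ((∏ i ∈ Finset.range n, (D i).card : ℕ) : ℝ≥0∞)⁻¹ :=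
        digitMeasure_preimage_le hD hcl
      _ ≤ 5 * (ENNReal.ofReal (((b : ℝ)⁻¹ ^ n) ^ (s : ℝ))⁻¹)⁻¹ := by
        gcongr
        rw [← ENNReal.ofReal_natCast]
        exact ENNReal.ofReal_le_ofReal (hN n hn)
      _ = ENNReal.ofReal (5 * ((b : ℝ)⁻¹ ^ n) ^ (s : ℝ)) := by
        rw [ENNReal.ofReal_inv_of_pos (by positivity), inv_inv, ENNReal.ofReal_mul (by norm_num)]
        simp
  set C : ℝ := 5 * (b : ℝ) ^ (s : ℝ) with hC
  have hC0 : 0 < C := by positivity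
  have frostman (A : Set ℝ) (hA : Metric.ediam A ≤ ENNReal.ofReal ((b : ℝ)⁻¹ ^ N)) :
      μ A ≤ ENNReal.ofReal C * Metric.ediam A ^ (s : ℝ) := by
    obtain ⟨δ, hδ0, hδ⟩ : ∃ δ : ℝ, 0 ≤ δ ∧ Metric.ediam A = ENNReal.ofReal δ :=
      ⟨_, ENNReal.toReal_nonneg,
        (ENNReal.ofReal_toReal (hA.trans_lt ENNReal.ofReal_lt_top).ne).symm⟩
    rcases hδ0.eq_or_lt with rfl | hδpos
    · have hlim : Tendsto (fun n : ℕ => ENNReal.ofReal (5 * ((b : ℝ)⁻¹ ^ n) ^ (s : ℝ))) atTop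
          (𝓝 0) := by
        rw [← ENNReal.ofReal_zero]
        refine ENNReal.tendsto_ofReal ?_
        have := ((tendsto_pow_atTop_nhds_zero_of_lt_one hr0.le hr1).rpow_const
          (p := (s : ℝ)) (Or.inr hs'.le)).const_mul 5
        simpa [Real.zero_rpow hs'.ne'] using this
      have : μ A ≤ 0 := ge_of_tendsto hlim <| by
        filter_upwards [eventually_ge_atTop N] with n hn
        exact key n hn A (by simp [hδ])
      exact this.trans zero_le
    · rw [hδ, ENNReal.ofReal_le_ofReal_iff (by positivity)] at hA
      obtain ⟨n, hn1, hn2⟩ := exists_nat_pow_near_of_lt_one hδpos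
        (hA.trans (pow_le_one₀ hr0.le hr1.le)) hr0 hr1
      have hNn : N ≤ n := by
        have := (pow_lt_pow_iff_right_of_lt_one₀ hr0 hr1).mp (hn1.trans_le hA)
        omega
      refine (key n hNn A (by rw [hδ]; exact ENNReal.ofReal_le_ofReal hn2)).trans ?_
      rw [hδ, ENNReal.ofReal_rpow_of_pos hδpos, ← ENNReal.ofReal_mul hC0.le]
      refine ENNReal.ofReal_le_ofReal ?_
      rw [hC, mul_assoc, ← Real.mul_rpow hb0.le hδ0]
      gcongr
      calc (b : ℝ)⁻¹ ^ n = b * (b : ℝ)⁻¹ ^ (n + 1) := by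
            rw [pow_succ']; field_simp
        _ ≤ b * δ := by gcongr
  have hle : (ENNReal.ofReal C)⁻¹ • μ ≤ μH[(s : ℝ)] := by
    refine Measure.le_hausdorffMeasure _ _ (ENNReal.ofReal ((b : ℝ)⁻¹ ^ N))
      (ENNReal.ofReal_pos.mpr (by positivity)) fun A hA => ?_
    rw [Measure.smul_apply, smul_eq_mul]
    calc (ENNReal.ofReal C)⁻¹ * μ A
        ≤ (ENNReal.ofReal C)⁻¹ * (ENNReal.ofReal C * Metric.ediam A ^ (s : ℝ)) := by
          gcongr; exact frostman A hA
      _ = Metric.ediam A ^ (s : ℝ) := by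
          rw [← mul_assoc, ENNReal.inv_mul_cancel (ENNReal.ofReal_pos.mpr hC0).ne'
            ENNReal.ofReal_ne_top, one_mul]
  refine le_dimH_of_hausdorffMeasure_ne_zero (ne_of_gt ?_)
  refine lt_of_lt_of_le ?_ (hle (digitSet D))
  rw [Measure.smul_apply, smul_eq_mul]
  exact ENNReal.mul_pos (ENNReal.inv_ne_zero.mpr ENNReal.ofReal_ne_top)
    (zero_lt_one.trans_le (one_le_map_digitMeasure_digitSet hD)).ne'

/-- Covering: if the number of prefixes of length `n` is infinitely often at most `b ^ (n d)`,
then the Hausdorff dimension is at most `d`. -/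
theorem dimH_digitSet_le {b : ℕ} (hb : 2 ≤ b) {D : ℕ → Finset (Fin b)} {d : ℝ≥0}
    (hfreq : ∃ᶠ n : ℕ in atTop,
      ((∏ i ∈ Finset.range n, (D i).card : ℕ) : ℝ) * ((b : ℝ)⁻¹ ^ n) ^ (d : ℝ) ≤ 1) :
    dimH (digitSet D) ≤ d := by
  have hr0 : (0 : ℝ) < (b : ℝ)⁻¹ := by positivity
  have hr1 : (b : ℝ)⁻¹ < 1 := inv_lt_one_of_one_lt₀ (by exact_mod_cast hb)
  let t (n : ℕ) (v : Fintype.piFinset fun i : Fin n => D i) : Set ℝ :=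
    Real.ofDigits '' {x : ℕ → Fin b | ∀ i : Fin n, x i = v.1 i}
  have hdiam (n : ℕ) (v : Fintype.piFinset fun i : Fin n => D i) :
      Metric.ediam (t n v) ≤ ENNReal.ofReal ((b : ℝ)⁻¹ ^ n) := by
    refine Metric.ediam_le ?_
    rintro _ ⟨x, hx, rfl⟩ _ ⟨y, hy, rfl⟩
    rw [edist_dist, Real.dist_eq, inv_pow]
    exact ENNReal.ofReal_le_ofReal <| Real.abs_ofDigits_sub_ofDigits_le
      fun i hi => (hx ⟨i, hi⟩).trans (hy ⟨i, hi⟩).symm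
  have hcard (n : ℕ) : Fintype.card (Fintype.piFinset fun i : Fin n => D i) =
      ∏ i ∈ Finset.range n, (D i).card := by
    rw [Fintype.card_coe, Fintype.card_piFinset, Finset.prod_range]
  have hcover (n : ℕ) : digitSet D ⊆ ⋃ v, t n v := by
    rintro _ ⟨x, hx, rfl⟩
    exact mem_iUnion.mpr ⟨⟨fun i => x i, Fintype.mem_piFinset.mpr fun i => hx i (mem_univ _)⟩,
      x, fun _ => rfl, rfl⟩
  have hsum (n : ℕ) : ∑ v, Metric.ediam (t n v) ^ (d : ℝ) ≤
      ENNReal.ofReal (((∏ i ∈ Finset.range n, (D i).card : ℕ) : ℝ) *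
        ((b : ℝ)⁻¹ ^ n) ^ (d : ℝ)) := by
    rw [ENNReal.ofReal_mul (Nat.cast_nonneg _), ENNReal.ofReal_natCast, ← hcard,
      ← ENNReal.ofReal_rpow_of_pos (pow_pos hr0 n), ← Finset.card_univ, ← nsmul_eq_mul]
    exact Finset.sum_le_card_nsmul _ _ _ fun v _ =>
      ENNReal.rpow_le_rpow (hdiam n v) d.coe_nonneg
  have hr : Tendsto (fun n : ℕ => ENNReal.ofReal ((b : ℝ)⁻¹ ^ n)) atTop (𝓝 0) := by
    rw [← ENNReal.ofReal_zero]
    exact ENNReal.tendsto_ofReal (tendsto_pow_atTop_nhds_zero_of_lt_one hr0.le hr1)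
  have hle : μH[(d : ℝ)] (digitSet D) ≤ 1 :=
    (Measure.hausdorffMeasure_le_liminf_sum (d : ℝ) (digitSet D) _ hr t (.of_forall hdiam)
      (.of_forall hcover)).trans <| liminf_le_of_frequently_le' <| hfreq.mono fun n hn =>
        (hsum n).trans (ENNReal.ofReal_le_one.mpr hn)
  exact dimH_le_of_hausdorffMeasure_ne_top (hle.trans_lt ENNReal.one_lt_top).ne

theorem dimH_digitSet {b : ℕ} (hb : 2 ≤ b) {D : ℕ → Finset (Fin b)} (hD : ∀ i, (D i).Nonempty) :
    dimH (digitSet D) = ENNReal.ofReal (liminf (fun n : ℕ =>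
      (∑ i ∈ Finset.range n, Real.log (D i).card) / (n * Real.log b)) atTop) := by
  have hb0 : (0 : ℝ) < b := by positivity
  have hlogb : 0 < Real.log b := Real.log_pos (by exact_mod_cast hb)
  have hcard (i : ℕ) : 0 < ((D i).card : ℝ) := by exact_mod_cast (hD i).card_pos
  have hprod (n : ℕ) : 0 < ((∏ i ∈ Finset.range n, (D i).card : ℕ) : ℝ) := by
    exact_mod_cast Finset.prod_pos fun i _ => (hD i).card_pos
  have hlog (n : ℕ) : Real.log ((∏ i ∈ Finset.range n, (D i).card : ℕ) : ℝ) =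
      ∑ i ∈ Finset.range n, Real.log (D i).card := by
    rw [Nat.cast_prod, Real.log_prod fun i _ => (hcard i).ne']
  have hlogpow (n : ℕ) (s : ℝ) : Real.log (((b : ℝ)⁻¹ ^ n) ^ s) = -(s * (n * Real.log b)) := by
    rw [Real.log_rpow (by positivity), Real.log_pow, Real.log_inv]
    ring
  set f : ℕ → ℝ := fun n =>
    (∑ i ∈ Finset.range n, Real.log (D i).card) / (n * Real.log b) with hf
  have hf0 (n : ℕ) : 0 ≤ f n :=
    div_nonneg (Finset.sum_nonneg fun i _ => Real.log_natCast_nonneg _) (by positivity)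
  have hf1 (n : ℕ) : f n ≤ 1 := by
    refine div_le_one_of_le₀ ?_ (by positivity)
    calc ∑ i ∈ Finset.range n, Real.log (D i).card ≤ ∑ _i ∈ Finset.range n, Real.log b := by
          refine Finset.sum_le_sum fun i _ => Real.log_le_log (hcard i) ?_
          exact_mod_cast (Finset.card_le_univ (D i)).trans_eq (Fintype.card_fin b)
      _ = n * Real.log b := by simp
  have hbdd : IsBoundedUnder (· ≥ ·) atTop f := isBoundedUnder_of ⟨0, hf0⟩
  have hcobdd : IsCoboundedUnder (· ≥ ·) atTop f := (isBoundedUnder_of ⟨1, hf1⟩).isCoboundedUnder_ge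
  apply le_antisymm
  · refine ENNReal.le_of_forall_pos_le_add ?_
    intro ε hε _
    set d : ℝ≥0 := Real.toNNReal (liminf f atTop) + ε with hd
    have hlt : liminf f atTop < d := by
      rw [hd, NNReal.coe_add]
      have : (0 : ℝ) < ε := hε
      linarith [Real.le_coe_toNNReal (liminf f atTop)]
    have hmain : dimH (digitSet D) ≤ d := by
      refine dimH_digitSet_le hb (((frequently_lt_of_liminf_lt hcobdd hlt).and_eventually
        (eventually_gt_atTop 0)).mono ?_)
      rintro n ⟨hn, hn0⟩
      have hn0' : (0 : ℝ) < n := by exact_mod_cast hn0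
      rw [hf, div_lt_iff₀ (by positivity), ← hlog] at hn
      rw [← Real.log_nonpos_iff (mul_nonneg (hprod n).le (by positivity)),
        Real.log_mul (hprod n).ne' (by positivity), hlogpow]
      linarith
    simpa [hd, ENNReal.ofReal] using hmain
  · refine ENNReal.le_of_forall_nnreal_lt fun s hs => ?_
    rcases eq_zero_or_pos s with rfl | hs0
    · simp
    have hlt : (s : ℝ) < liminf f atTop := by
      have : 0 < liminf f atTop := ENNReal.ofReal_pos.mp (zero_le.trans_lt hs)
      rwa [← ENNReal.ofReal_coe_nnreal, ENNReal.ofReal_lt_ofReal_iff this] at hs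
    obtain ⟨N, hN⟩ := eventually_atTop.mp
      ((eventually_lt_of_lt_liminf hlt hbdd).and (eventually_gt_atTop 0))
    refine le_dimH_digitSet hb hD hs0 (N := N) fun n hn => ?_
    obtain ⟨hn, hn0⟩ := hN n hn
    have hn0' : (0 : ℝ) < n := by exact_mod_cast hn0
    rw [hf, lt_div_iff₀ (by positivity), ← hlog] at hn
    rw [← Real.log_le_log_iff (by positivity) (hprod n), Real.log_inv, hlogpow]
    linarith

theorem val_succ_digits_eq_ofDigits {b : ℕ} (u : ℕ → ℕ) (x : ℕ → Fin b)
    (h : ∀ i, u (i + 1) = x i) : val b u = Real.ofDigits x := by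
  simp only [val, Real.ofDigits, Real.ofDigitsTerm, h, div_eq_mul_inv]

/-- The digits `u` with `(u, a) ∈ J`, as elements of `Fin b`. -/
def rowDigits (b : ℕ) (J : Finset (ℕ × ℕ)) (a : ℕ) : Finset (Fin b) :=
  Finset.univ.filter fun u => ((u : ℕ), a) ∈ J

theorem card_rowDigits {b : ℕ} {J : Finset (ℕ × ℕ)}
    (hJ : J ⊆ Finset.range b ×ˢ Finset.range b) (a : ℕ) :
    (rowDigits b J a).card = (J2 J a).card := by
  refine Finset.card_bij (fun u _ => ((u : ℕ), a)) ?_ ?_ ?_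
  · intro u hu
    simpa [rowDigits, J2] using hu
  · intro u _ v _ h
    exact Fin.ext (Prod.ext_iff.mp h).1
  · rintro ⟨u, v⟩ huv
    obtain ⟨hmem, rfl⟩ := Finset.mem_filter.mp huv
    have hu := (Finset.mem_product.mp (hJ hmem)).1
    exact ⟨⟨u, Finset.mem_range.mp hu⟩, by simpa [rowDigits] using hmem, rfl⟩

theorem slice_eq_digitSet {b : ℕ} {J : Finset (ℕ × ℕ)}
    (hJ : J ⊆ Finset.range b ×ˢ Finset.range b) (w : ℕ → ℕ) :
    {x : ℝ | ∃ xd : ℕ → ℕ, (∀ i, 1 ≤ i → (xd i, w i) ∈ J) ∧ x = val b xd} =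
      digitSet fun i => rowDigits b J (w (i + 1)) := by
  ext x
  constructor
  · rintro ⟨xd, hxd, rfl⟩
    have hlt (i : ℕ) : xd (i + 1) < b :=
      Finset.mem_range.mp (Finset.mem_product.mp (hJ (hxd (i + 1) (by omega)))).1
    refine ⟨fun i => ⟨xd (i + 1), hlt i⟩, fun i _ => ?_,
      (val_succ_digits_eq_ofDigits _ _ fun _ => rfl).symm⟩
    simpa [rowDigits] using hxd (i + 1) (by omega)
  · rintro ⟨y, hy, rfl⟩
    refine ⟨fun i => y (i - 1), fun i hi => ?_,
      (val_succ_digits_eq_ofDigits _ _ fun _ => rfl).symm⟩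
    have := hy (i - 1) (mem_univ _)
    simpa [rowDigits, Nat.sub_add_cancel hi] using this

theorem sum_freqCount_mul {b : ℕ} {w : ℕ → ℕ} (hw : ∀ i, 1 ≤ i → w i < b) (g : ℕ → ℝ) (n : ℕ) :
    ∑ a ∈ Finset.range b, (freqCount w a n : ℝ) * g a =
      ∑ i ∈ Finset.range n, g (w (i + 1)) := by
  have hmaps : ∀ i ∈ Finset.Icc 1 n, w i ∈ Finset.range b := fun i hi =>
    Finset.mem_range.mpr (hw i (Finset.mem_Icc.mp hi).1)
  calc ∑ a ∈ Finset.range b, (freqCount w a n : ℝ) * g a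
      = ∑ a ∈ Finset.range b, ∑ i ∈ (Finset.Icc 1 n).filter (fun i => w i = a), g (w i) := by
        refine Finset.sum_congr rfl fun a _ => ?_
        rw [Finset.sum_congr rfl fun i hi => congrArg g (Finset.mem_filter.mp hi).2,
          Finset.sum_const, nsmul_eq_mul, freqCount]
    _ = ∑ i ∈ Finset.Icc 1 n, g (w i) := Finset.sum_fiberwise_of_maps_to hmaps _
    _ = ∑ i ∈ Finset.range n, g (w (i + 1)) := by
        rw [Finset.range_eq_Ico, Finset.sum_Ico_add' (fun i => g (w i)) 0 n 1]
        rfl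

theorem stmt_4
    (b : ℕ) (J : Finset (ℕ × ℕ)) (hb : 2 ≤ b)
    (hJ : J ⊂ Finset.range b ×ˢ Finset.range b) (hJcard : 2 ≤ J.card)
    (w : ℕ → ℕ) (hw : ∀ i, 1 ≤ i → w i < b)
    (hJ2ne : ∀ i, 1 ≤ i → (J2 J (w i)).Nonempty)
    (hunique : ∀ u : ℕ → ℕ, (∀ i, 1 ≤ i → u i < b) → val b u = val b w →
      ∀ i, 1 ≤ i → u i = w i) :
    dimH {x : ℝ | ∃ xd : ℕ → ℕ, (∀ i, 1 ≤ i → (xd i, w i) ∈ J) ∧ x = val b xd} =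
      ENNReal.ofReal (Filter.liminf (fun n : ℕ =>
        (∑ a ∈ Finset.range b, (freqCount w a n : ℝ) * Real.log ((J2 J a).card)) /
          ((n : ℝ) * Real.log b)) atTop) ∧
    ∀ p : ℕ → ℝ,
      (∀ a, a < b → Tendsto (fun n : ℕ => (freqCount w a n : ℝ) / n) atTop (𝓝 (p a))) →
      dimH {x : ℝ | ∃ xd : ℕ → ℕ, (∀ i, 1 ≤ i → (xd i, w i) ∈ J) ∧ x = val b xd} =
        ENNReal.ofReal ((∑ a ∈ Finset.range b, p a * Real.log ((J2 J a).card)) / Real.log b) := by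
  have hdim : dimH {x : ℝ | ∃ xd : ℕ → ℕ, (∀ i, 1 ≤ i → (xd i, w i) ∈ J) ∧ x = val b xd} =
      ENNReal.ofReal (Filter.liminf (fun n : ℕ =>
        (∑ a ∈ Finset.range b, (freqCount w a n : ℝ) * Real.log ((J2 J a).card)) /
          ((n : ℝ) * Real.log b)) atTop) := by
    have hne (i : ℕ) : (rowDigits b J (w (i + 1))).Nonempty := by
      rw [← Finset.card_pos, card_rowDigits hJ.1]
      exact (hJ2ne (i + 1) (by omega)).card_pos
    rw [slice_eq_digitSet hJ.1, dimH_digitSet hb hne]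
    simp only [card_rowDigits hJ.1, sum_freqCount_mul hw fun a => Real.log (J2 J a).card]
  refine ⟨hdim, fun p hp => ?_⟩
  rw [hdim]
  congr 1
  refine Tendsto.liminf_eq ?_
  have hlim := (tendsto_finsetSum (Finset.range b) fun a ha =>
    (hp a (Finset.mem_range.mp ha)).mul_const (Real.log (J2 J a).card)).div_const (Real.log b)
  refine hlim.congr fun n => ?_
  rw [← div_div, Finset.sum_div (a := (n : ℝ))]
  congr 1
  exact Finset.sum_congr rfl fun a _ => by ring

end ShrinkingRect
end
end

section
/- Fix (z,w) ∈ Λ with representative sequence (z_i,w_i)_{i∈ℕ}. Suppose λ := lim_{n→∞} λ(n)/n and ξ := lim_{n→∞} ξ(n)/n exist with ξ > λ, that for each a ∈ {0,…,b−1} the digit frequency p_a(z,w) := lim_{n→∞} #{1 ≤ i ≤ n : w_i = a}/n exists, and that p_0(z,w) < 1 and p_{b−1}(z,w) < 1. Then lim_{n→∞} k_w(n)/n = ξ, where k_w(n) is the largest integer with 1 ≤ k_w(n) < ξ(n) such that every (x_i,y_i)_{i∈ℕ} ∈ M_n(z,w) satisfies y_{i+n} = w_i for all 1 ≤ i ≤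 k_w(n). -/
open Set Filter Topology MeasureTheory
open scoped ENNReal NNReal Topology

noncomputable section

namespace ShrinkingRect

/-- The number of indices `1 ≤ i ≤ n` with `u i ≠ a`. -/
def offCount (u : ℕ → ℕ) (a n : ℕ) : ℕ := ((Finset.Icc 1 n).filter fun i => u i ≠ a).card

theorem freqCount_add_offCount (u : ℕ → ℕ) (a n : ℕ) :
    freqCount u a n + offCount u a n = n := by
  have h := Finset.card_filter_add_card_filter_not (s := Finset.Icc 1 n) (fun i => u i = a)
  simpa [freqCount, offCount] using h

/-- A digit of asymptotic frequency less than `1` cannot fill a terminal run of positive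
proportion. -/
theorem eventually_no_long_run (u : ℕ → ℕ) (a : ℕ) (c ε : ℝ) (hc : c < 1) (hε : 0 < ε)
    (hu : Tendsto (fun n : ℕ => (freqCount u a n : ℝ) / n) atTop (𝓝 c)) :
    ∀ᶠ N : ℕ in atTop, ∀ j : ℕ, (j : ℝ) < (1 - ε) * N → ∃ i, j < i ∧ i ≤ N ∧ u i ≠ a := by
  set δ := 1 - c with hδ
  have hδ0 : 0 < δ := by linarith
  set η := δ * ε / 2 with hη
  have hη0 : 0 < η := by positivity
  have hfreq : ∀ n, (offCount u a n : ℝ) = n - freqCount u a n := fun n => by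
    have h : (freqCount u a n : ℝ) + offCount u a n = n := mod_cast freqCount_add_offCount u a n
    linarith
  have hbounds : ∀ᶠ n : ℕ in atTop,
      (δ - η) * n ≤ offCount u a n ∧ (offCount u a n : ℝ) ≤ (δ + η) * n := by
    filter_upwards [hu.eventually (Ioo_mem_nhds (show c - η < c by linarith)
      (show c < c + η by linarith)), eventually_gt_atTop 0] with n hn hn0
    have hn0' : (0 : ℝ) < n := mod_cast hn0
    have h1 := (lt_div_iff₀ hn0').1 hn.1
    have h2 := (div_lt_iff₀ hn0').1 hn.2
    rw [hfreq]
    constructor <;> linarith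
  obtain ⟨K, hK⟩ := eventually_atTop.1 hbounds
  have hupper : ∀ n : ℕ, (offCount u a n : ℝ) ≤ (δ + η) * n + K := by
    intro n
    rcases le_total K n with h | h
    · have := (hK n h).2
      have : (0 : ℝ) ≤ K := Nat.cast_nonneg K
      linarith
    · have h1 : offCount u a n ≤ K := by
        have := freqCount_add_offCount u a n
        omega
      have h2 : (offCount u a n : ℝ) ≤ K := mod_cast h1
      have : 0 ≤ (δ + η) * n := by positivity
      linarith
  have hlarge : ∀ᶠ N : ℕ in atTop, (K : ℝ) / (η * ε) < N :=
    tendsto_natCast_atTop_atTop.eventually_gt_atTop _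
  filter_upwards [hlarge, eventually_ge_atTop K] with N hN hNK j hj
  by_contra! hrun
  have hle : offCount u a N ≤ offCount u a j := by
    refine Finset.card_le_card fun i hi => ?_
    simp only [Finset.mem_filter, Finset.mem_Icc] at hi ⊢
    refine ⟨⟨hi.1.1, ?_⟩, hi.2⟩
    by_contra! hij
    exact hi.2 (hrun i hij hi.1.2)
  have hle' : (offCount u a N : ℝ) ≤ offCount u a j := mod_cast hle
  have h1 := (hK N hNK).1
  have h2 := hupper j
  have h3 := (div_lt_iff₀ (by positivity : 0 < η * ε)).1 hN
  have h4 : (δ + η) * j ≤ (δ + η) * ((1 - ε) * N) := by gcongr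
  have h5 : (δ - η) * N - (δ + η) * ((1 - ε) * N) = N * (η * ε) := by
    rw [hη]; ring
  linarith

/-- Close digit strings agree up to every index after which the centre has both a digit other
than `0` and a digit other than `b - 1`. -/
theorem closeCond.eq_of_no_run {b L n m : ℕ} {zd xd : ℕ → ℕ} (h : closeCond b L n zd xd)
    (hm : m < L) (hz : ∀ i, 1 ≤ i → zd i < b) (hxd : ∀ i, 1 ≤ i → xd i < b)
    (h0 : ∀ j ≤ m, ∃ i, j < i ∧ i < L ∧ zd i ≠ 0)
    (h1 : ∀ j ≤ m, ∃ i, j < i ∧ i < L ∧ zd i ≠ b - 1) :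
    ∀ i, 1 ≤ i → i ≤ m → xd (i + n) = zd i := by
  intro i hi him
  rcases h with h | ⟨j, hj1, -, hpre, h⟩
  · exact h i hi (by omega)
  rcases lt_or_ge i j with hij | hij
  · exact hpre i hi (by omega)
  exfalso
  rcases h with ⟨-, h⟩ | ⟨-, h⟩
  · obtain ⟨k, hk1, hk2, hk3⟩ := h0 j (by omega)
    have := h k hk1 hk2
    have := hxd (k + n) (by omega)
    omega
  · obtain ⟨k, hk1, hk2, hk3⟩ := h1 j (by omega)
    have := h k hk1 hk2
    have := hz k (by omega)
    omega

theorem wdig_lt {b : ℕ} {J : Finset (ℕ × ℕ)} (hJ : J ⊆ Finset.range b ×ˢ Finset.range b)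
    (R : RepMap b J) {q : ℝ × ℝ} (hq : q ∈ carpet b J) {i : ℕ} (hi : 1 ≤ i) :
    wdig R q i < b :=
  Finset.mem_range.1 (Finset.mem_product.1 (hJ (R.mem_J q hq i hi))).2

theorem stmt_10
    (b : ℕ) (J : Finset (ℕ × ℕ)) (hb : 2 ≤ b)
    (hJ : J ⊂ Finset.range b ×ˢ Finset.range b) (hJcard : 2 ≤ J.card)
    (R : RepMap b J) (lam xi : ℕ → ℕ)
    (hlam_pos : ∀ n, 1 ≤ lam n) (hle : ∀ n, lam n ≤ xi n)
    (hlam_top : Tendsto lam atTop atTop)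
    (z w : ℝ) (hzw : (z, w) ∈ carpet b J)
    (l x : ℝ)
    (hl : Tendsto (fun n : ℕ => (lam n : ℝ) / n) atTop (𝓝 l))
    (hx : Tendsto (fun n : ℕ => (xi n : ℝ) / n) atTop (𝓝 x))
    (hlx : l < x)
    (p : ℕ → ℝ)
    (hp : ∀ a, a < b →
      Tendsto (fun n : ℕ => (freqCount (wdig R (z, w)) a n : ℝ) / n) atTop (𝓝 (p a)))
    (hp0 : p 0 < 1) (hpb : p (b - 1) < 1)
    (kw : ℕ → ℕ)
    (hkw : ∀ n, kw n = sSup {k : ℕ | 1 ≤ k ∧ k < xi n ∧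
      ∀ q ∈ Mset R lam xi (z, w) n, ∀ i, 1 ≤ i → i ≤ k →
        wdig R q (i + n) = wdig R (z, w) i}) :
    Tendsto (fun n : ℕ => (kw n : ℝ) / n) atTop (𝓝 x) := by
  have hx0 : 0 < x := (ge_of_tendsto' hl fun n => by positivity).trans_lt hlx
  have hxi : Tendsto xi atTop atTop := tendsto_atTop_mono hle hlam_top
  have hlt : ∀ n, 1 ≤ xi n := fun n => (hlam_pos n).trans (hle n)
  have hkw_le : ∀ n, kw n ≤ xi n := fun n => by
    rw [hkw]
    exact csSup_le' fun k hk => hk.2.1.le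
  have hlower : ∀ ε : ℝ, 0 < ε → ε < 1 →
      ∀ᶠ n : ℕ in atTop, (1 - ε) * ((xi n : ℝ) - 1) - 1 ≤ kw n := by
    intro ε hε hε1
    have hpred : Tendsto (fun n => xi n - 1) atTop atTop :=
      (tendsto_sub_atTop_nat 1).comp hxi
    filter_upwards [
      hpred.eventually (eventually_no_long_run _ 0 _ ε hp0 hε (hp 0 (by omega))),
      hpred.eventually (eventually_no_long_run _ (b - 1) _ ε hpb hε (hp (b - 1) (by omega)))]
      with n h0 h1
    set N := xi n - 1 with hN
    have hNcast : (N : ℝ) = xi n - 1 := by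
      rw [hN, Nat.cast_sub (hlt n), Nat.cast_one]
    rw [← hNcast]
    set m := ⌈(1 - ε) * (N : ℝ)⌉₊ - 1 with hm
    have hceil := Nat.le_ceil ((1 - ε) * (N : ℝ))
    have hm_ge : (1 - ε) * (N : ℝ) - 1 ≤ m := by
      have : ⌈(1 - ε) * (N : ℝ)⌉₊ ≤ m + 1 := by omega
      have : (⌈(1 - ε) * (N : ℝ)⌉₊ : ℝ) ≤ m + 1 := mod_cast this
      linarith
    rcases Nat.eq_zero_or_pos m with hm0 | hm1
    · rw [hm0, Nat.cast_zero] at hm_ge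
      exact hm_ge.trans (Nat.cast_nonneg _)
    have hm_lt : ∀ j ≤ m, (j : ℝ) < (1 - ε) * N := fun j hj =>
      Nat.lt_ceil.1 (by omega)
    have hmN : m < xi n := by
      have h2 : (m : ℝ) < N := (hm_lt m le_rfl).trans_le
        (mul_le_of_le_one_left (Nat.cast_nonneg _) (by linarith))
      have : m < N := mod_cast h2
      omega
    refine hm_ge.trans (Nat.cast_le.2 ?_)
    rw [hkw]
    refine le_csSup ⟨xi n, fun k hk => hk.2.1.le⟩ ⟨hm1, hmN, fun q hq => ?_⟩
    have hshift : ∀ {a : ℕ}, (∀ j : ℕ, (j : ℝ) < (1 - ε) * N →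
        ∃ i, j < i ∧ i ≤ N ∧ wdig R (z, w) i ≠ a) →
        ∀ j ≤ m, ∃ i, j < i ∧ i < xi n ∧ wdig R (z, w) i ≠ a := fun h j hj => by
      obtain ⟨i, hi1, hi2, hi3⟩ := h j (hm_lt j hj)
      exact ⟨i, hi1, by omega, hi3⟩
    exact closeCond.eq_of_no_run (xd := wdig R q) (zd := wdig R (z, w)) hq.2.2 hmN
      (fun i hi => wdig_lt hJ.subset R hzw hi) (fun i hi => wdig_lt hJ.subset R hq.1 hi)
      (hshift h0) (hshift h1)
  refine tendsto_order.2 ⟨fun a ha => ?_, fun a ha => ?_⟩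
  · obtain ⟨ε, hε, hε1, hεa⟩ : ∃ ε : ℝ, 0 < ε ∧ ε < 1 ∧ a < (1 - ε) * x := by
      have hcont : Tendsto (fun ε : ℝ => (1 - ε) * x) (𝓝[>] 0) (𝓝 x) := by
        have : Continuous fun ε : ℝ => (1 - ε) * x := by fun_prop
        simpa using (this.tendsto 0).mono_left nhdsWithin_le_nhds
      obtain ⟨ε, hεa, hε⟩ := ((hcont.eventually_const_lt ha).and
        (Ioo_mem_nhdsGT (zero_lt_one' ℝ))).exists
      exact ⟨ε, hε.1, hε.2, hεa⟩
    have hlim : Tendsto (fun n : ℕ => (1 - ε) * ((xi n : ℝ) / n - 1 / n) - 1 / n) atTop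
        (𝓝 ((1 - ε) * x)) := by
      have h1 := tendsto_one_div_atTop_nhds_zero_nat (𝕜 := ℝ)
      simpa using ((hx.sub h1).const_mul (1 - ε)).sub h1
    filter_upwards [hlower ε hε hε1, hlim.eventually_const_lt hεa] with n hn hn'
    refine hn'.trans_le ?_
    calc (1 - ε) * ((xi n : ℝ) / n - 1 / n) - 1 / n
        = ((1 - ε) * ((xi n : ℝ) - 1) - 1) / n := by ring
      _ ≤ kw n / n := by gcongr
  · filter_upwards [hx.eventually_lt_const ha] with n hn
    refine lt_of_le_of_lt ?_ hn
    have := hkw_le n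
    gcongr

end ShrinkingRect
end
end
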